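/- arXiv:1311.3297 — 2 statements merged into one kernel-verified Lean document; each statement's English description precedes it below -/
import Mathlib

section
/- The smallest eigenvalue of the 128×128 symmetric 0-1 matrix A(g₀) equals e₁ = −1 − 3√2, and the corresponding eigenspace is four-dimensional, with orthonormal basis {ψ_{z,a} : z, a ∈ {0,1}}. -/
open scoped Matrix

namespace GG

/-- `ω = e^{iπ/4}`. -/
noncomputable def omega : ℂ := Complex.exp (Real.pi * Complex.I / 4)

/-- The cyclic shift on `ℂ⁸`: `S|j⟩ = |j+1 mod 8⟩`, i.e. `⟨i|S|j⟩ = [i = j+1]`. -/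
noncomputable def S8 : Matrix (Fin 8) (Fin 8) ℂ :=
  Matrix.of fun i j => if i = j + 1 then 1 else 0

/-- `|ω⟩ = (1/√8) Σ_{j=0}^{7} ω^{−j} |j⟩`. -/
noncomputable def omegaVec : Fin 8 → ℂ :=
  fun j => ((1 : ℝ) / Real.sqrt 8 : ℝ) * omega ^ (-(j : ℤ))

/-- The Hadamard gate `H = (1/√2)[[1,1],[1,−1]]`. -/
noncomputable def Hmat : Matrix (Fin 2) (Fin 2) ℂ :=
  ((1 : ℝ) / Real.sqrt 2 : ℝ) • (!![1, 1; 1, -1] : Matrix (Fin 2) (Fin 2) ℂ)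

/-- The gate `T = diag(1, ω)`. -/
noncomputable def Tmat : Matrix (Fin 2) (Fin 2) ℂ := !![1, 0; 0, omega]

/-- The gates `U₁,…,U₈` of the circuit `C₀` (0-indexed):
`U₁ = U₂ = U₇ = U₈ = H`, `U₃ = U₅ = HT`, `U₄ = U₆ = (HT)†`. -/
noncomputable def gate : Fin 8 → Matrix (Fin 2) (Fin 2) ℂ :=
  ![Hmat, Hmat, Hmat * Tmat, (Hmat * Tmat)ᴴ, Hmat * Tmat, (Hmat * Tmat)ᴴ, Hmat, Hmat]

/-- For a matrix `W` all of whose entries are `0` or integer powers of `ω`, the operator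
`B(W)` obtained by replacing each entry `ω^k` by `S^k` (and each zero entry by the zero
block): since `(S^k)_{ij} = [i−j ≡ k (mod 8)]` and the powers `ω^0,…,ω^7` are distinct,
this is implemented by `B(W)_{(a,i),(b,j)} = [W a b = ω^{(i−j) mod 8}]`. -/
noncomputable def Bmat {κ : Type*} (W : Matrix κ κ ℂ) :
    Matrix (κ × Fin 8) (κ × Fin 8) ℂ :=
  Matrix.of fun p q => if W p.1 q.1 = omega ^ ((p.2 - q.2 : Fin 8) : ℕ) then 1 else 0

/-- The vertex set of the graph `g₀`: `{0,1} × [8] × {0,…,7}`, a qubit register, a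
clock register (labels `1,…,8`, represented by `Fin 8` with label `t ↔ index t−1` and
periodic convention `|9⟩ = |1⟩`), and an 8-level ancilla. -/
abbrev G0V := Fin 2 × Fin 8 × Fin 8

/-- `H_prop = Σ_{t=1}^{8}( (B(U_t)†)_{13} ⊗ (|t⟩⟨t+1|)_2 + (B(U_t))_{13} ⊗ (|t+1⟩⟨t|)_2 )`,
where `B(U_t)` is obtained from the matrix `−√2·U_t` by the substitution `ω^k ↦ S^k`. -/
noncomputable def Hprop0 : Matrix G0V G0V ℂ :=
  Matrix.of fun p q => ∑ t : Fin 8,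
    ((if p.2.1 = t ∧ q.2.1 = t + 1 then
        (Bmat ((-(Real.sqrt 2) : ℂ) • gate t))ᴴ (p.1, p.2.2) (q.1, q.2.2) else 0)
      + (if p.2.1 = t + 1 ∧ q.2.1 = t then
        Bmat ((-(Real.sqrt 2) : ℂ) • gate t) (p.1, p.2.2) (q.1, q.2.2) else 0))

/-- `H_penalty = 1 ⊗ 1 ⊗ (S³ + S⁴ + S⁵)`. -/
noncomputable def Hpen0 : Matrix G0V G0V ℂ :=
  Matrix.of fun p q =>
    if p.1 = q.1 ∧ p.2.1 = q.2.1 then (S8 ^ 3 + S8 ^ 4 + S8 ^ 5) p.2.2 q.2.2 else 0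

/-- The adjacency matrix `A(g₀) = H_prop + H_penalty` of the 128-vertex graph `g₀`. -/
noncomputable def Ag0 : Matrix G0V G0V ℂ := Hprop0 + Hpen0

/-- `e₁ = −1 − 3√2`. -/
noncomputable def e1 : ℝ := -1 - 3 * Real.sqrt 2

/-- Clock-register coefficients of the states `ψ_{z,0}`: the qubit register holds `|z⟩`
at clock labels `1,3,5,7` (indices `0,2,4,6`), `H|z⟩` at labels `2,8` (indices `1,7`),
and `HT|z⟩` at labels `4,6` (indices `3,5`). -/
noncomputable def clockCoef (z : Fin 2) (t : Fin 8) (x : Fin 2) : ℂ :=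
  if t = 0 ∨ t = 2 ∨ t = 4 ∨ t = 6 then (if x = z then 1 else 0)
  else if t = 1 ∨ t = 7 then Hmat x z
  else (Hmat * Tmat) x z

/-- The ground states `ψ_{z,a}` of `A(g₀)`:
`ψ_{z,0} = (1/√8)( |z⟩(|1⟩+|3⟩+|5⟩+|7⟩) + H|z⟩(|2⟩+|8⟩) + HT|z⟩(|4⟩+|6⟩) ) ⊗ |ω⟩` and
`ψ_{z,1} = (ψ_{z,0})^*` (entrywise complex conjugate). -/
noncomputable def psi (z a : Fin 2) : G0V → ℂ :=
  if a = 0 then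
    fun p => ((1 : ℝ) / Real.sqrt 8 : ℝ) * clockCoef z p.2.1 p.1 * omegaVec p.2.2
  else
    fun p => starRingEnd ℂ
      (((1 : ℝ) / Real.sqrt 8 : ℝ) * clockCoef z p.2.1 p.1 * omegaVec p.2.2)

end GG
open GG

namespace GGP

/-- powers of omega indexed by `Fin 8` -/
noncomputable def e (j : Fin 8) : ℂ := omega ^ (j : ℕ)

lemma omega_prim : IsPrimitiveRoot omega 8 := by
  have h := Complex.isPrimitiveRoot_exp 8 (by norm_num)
  have : omega = Complex.exp (2 * Real.pi * Complex.I / (8 : ℕ)) := by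
    unfold omega; congr 1; push_cast; ring
  rw [this]; exact h

lemma omega_val : omega = (Real.sqrt 2 / 2 : ℂ) * (1 + Complex.I) := by
  have h : (Real.pi * Complex.I / 4 : ℂ) = ((Real.pi / 4 : ℝ) : ℂ) * Complex.I := by
    push_cast; ring
  unfold omega
  rw [h, Complex.exp_mul_I, ← Complex.ofReal_cos, ← Complex.ofReal_sin,
    Real.cos_pi_div_four, Real.sin_pi_div_four]
  push_cast; ring

lemma sq2 : (Real.sqrt 2 : ℂ) * Real.sqrt 2 = 2 := by
  rw [← Complex.ofReal_mul, Real.mul_self_sqrt (by norm_num)]; norm_num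

lemma sq2' : (Real.sqrt 2 : ℂ) ^ 2 = 2 := by rw [pow_two, sq2]

lemma sq2_ne : (Real.sqrt 2 : ℂ) ≠ 0 := by
  intro h; have := sq2; rw [h] at this; norm_num at this

lemma omega_sq : omega ^ 2 = Complex.I := by
  rw [omega_val]
  have := sq2'
  linear_combination (1/4) * (1+Complex.I)^2 * this + (1/2) * Complex.I_sq

lemma omega_four : omega ^ 4 = -1 := by
  have : omega ^ 4 = (omega ^ 2) ^ 2 := by ring
  rw [this, omega_sq, Complex.I_sq]

lemma omega_ne : omega ≠ 0 := by
  intro h; have := omega_four; rw [h] at this; norm_num at this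

lemma sqrt_omega : (Real.sqrt 2 : ℂ) = omega - omega ^ 3 := by
  have h3 : omega ^ 3 = omega * omega ^ 2 := by ring
  rw [h3, omega_sq, omega_val]
  linear_combination (Real.sqrt 2 / 2 : ℂ) * Complex.I_sq

lemma e_add (i j : Fin 8) : e (i + j) = e i * e j := by
  unfold e
  rw [← pow_add, Fin.val_add, ← pow_mod_orderOf, ← pow_mod_orderOf omega (_ + _),
    ← omega_prim.eq_orderOf, Nat.mod_mod]

lemma e_zero : e 0 = 1 := by simp [e]

lemma e_inj {i j : Fin 8} : e i = e j ↔ i = j := by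
  constructor
  · intro h
    exact Fin.ext (omega_prim.pow_inj i.2 j.2 h)
  · rintro rfl; rfl

lemma e_mul_neg (i : Fin 8) : e i * e (-i) = 1 := by
  rw [← e_add, add_neg_cancel, e_zero]

lemma conj_omega : (starRingEnd ℂ) omega = omega⁻¹ := by
  have h : ‖omega‖ = 1 := omega_prim.norm'_eq_one (by norm_num)
  rw [Complex.inv_def, Complex.normSq_eq_norm_sq, h]; simp

lemma conj_e (i : Fin 8) : (starRingEnd ℂ) (e i) = e (-i) := by
  have h := e_mul_neg i
  have h1 : e i ≠ 0 := left_ne_zero_of_mul_eq_one h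
  have : (starRingEnd ℂ) (e i) * e i = 1 := by
    unfold e
    rw [map_pow, conj_omega, ← mul_pow, inv_mul_cancel₀ omega_ne, one_pow]
  apply mul_left_cancel₀ h1
  rw [h, mul_comm, this]

lemma norm_e (i : Fin 8) : ‖e i‖ = 1 := by
  unfold e
  rw [norm_pow, omega_prim.norm'_eq_one (by norm_num), one_pow]

lemma e_add_four (i : Fin 8) : e (i + 4) = - e i := by
  rw [e_add]; have : e 4 = -1 := omega_four
  rw [this]; ring

/-- exponent tables -/
def n (t : Fin 8) : Fin 2 → Fin 2 → Fin 8 :=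
  match t with
  | 2 | 4 => ![![4, 5], ![4, 1]]
  | 3 | 5 => ![![4, 4], ![3, 7]]
  | _ => ![![4, 4], ![4, 0]]

lemma rinv : (Real.sqrt 2 : ℂ) * (Real.sqrt 2 : ℂ)⁻¹ = 1 := mul_inv_cancel₀ sq2_ne

lemma HT_eq : Hmat * Tmat = !![(Real.sqrt 2 : ℂ)⁻¹, (Real.sqrt 2 : ℂ)⁻¹ * omega;
    (Real.sqrt 2 : ℂ)⁻¹, -((Real.sqrt 2 : ℂ)⁻¹ * omega)] := by
  ext a b
  fin_cases a <;> fin_cases b <;>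
    simp [Hmat, Tmat, Matrix.mul_apply, Fin.sum_univ_two]

lemma H_eq : Hmat = !![(Real.sqrt 2 : ℂ)⁻¹, (Real.sqrt 2 : ℂ)⁻¹;
    (Real.sqrt 2 : ℂ)⁻¹, -((Real.sqrt 2 : ℂ)⁻¹)] := by
  ext a b
  fin_cases a <;> fin_cases b <;> simp [Hmat]

lemma omega_inv : omega⁻¹ = - omega ^ 3 := by
  have := omega_four
  field_simp [omega_ne]
  linear_combination this

lemma HTd_eq : (Hmat * Tmat)ᴴ = !![(Real.sqrt 2 : ℂ)⁻¹, (Real.sqrt 2 : ℂ)⁻¹;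
    -((Real.sqrt 2 : ℂ)⁻¹ * omega ^ 3), ((Real.sqrt 2 : ℂ)⁻¹ * omega ^ 3)] := by
  rw [HT_eq]
  ext a b
  fin_cases a <;> fin_cases b <;> simp [Matrix.conjTranspose_apply, conj_omega, omega_inv]

lemma e3 : e 3 = omega ^ 3 := rfl
lemma e4 : e 4 = omega ^ 4 := rfl
lemma e5 : e 5 = omega ^ 5 := rfl
lemma e7 : e 7 = omega ^ 7 := rfl
lemma e1' : e 1 = omega := pow_one _

lemma o5 : omega ^ 5 = - omega := by linear_combination omega * omega_four
lemma o7 : omega ^ 7 = - omega ^ 3 := by linear_combination omega ^ 3 * omega_four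

lemma gate_entry (t : Fin 8) (a b : Fin 2) :
    gate t a b = -(Real.sqrt 2 : ℂ)⁻¹ * e (n t a b) := by
  unfold gate
  rw [HTd_eq, HT_eq, H_eq]
  fin_cases t <;> fin_cases a <;> fin_cases b <;>
    simp [n, e_zero, e3, e4, e5, e7, e1', omega_four, o5, o7]

lemma gate_entry' (t : Fin 8) (a b : Fin 2) :
    ((-(Real.sqrt 2) : ℂ) • gate t) a b = e (n t a b) := by
  rw [Matrix.smul_apply, gate_entry, smul_eq_mul]
  linear_combination e (n t a b) * rinv

lemma Bmat_entry (t : Fin 8) (a b : Fin 2) (i j : Fin 8) :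
    Bmat ((-(Real.sqrt 2) : ℂ) • gate t) (a, i) (b, j)
      = if i = j + n t a b then 1 else 0 := by
  simp only [Bmat, Matrix.of_apply, gate_entry']
  change (if e _ = e _ then _ else _) = _
  simp only [e_inj]
  congr 1
  rw [eq_iff_iff]
  constructor
  · intro h; rw [h]; abel
  · intro h; rw [h]; abel

lemma S8_pow (m : ℕ) (i j : Fin 8) :
    (S8 ^ m) i j = if i = j + Fin.ofNat 8 m then 1 else 0 := by
  induction m generalizing i j with
  | zero => simp [Matrix.one_apply]
  | succ m ih =>
    rw [pow_succ, Matrix.mul_apply]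
    simp only [ih]
    simp only [S8, Matrix.of_apply, mul_ite, mul_one, mul_zero, Finset.sum_ite_eq',
      Finset.mem_univ, if_true]
    have : (Fin.ofNat 8 (m+1)) = 1 + Fin.ofNat 8 m := by
      ext; simp [Fin.val_add, add_comm]
    rw [this, add_assoc]

lemma Hpen_entry (x y : Fin 2) (t s i j : Fin 8) :
    Hpen0 (x, t, i) (y, s, j) = if x = y then if t = s then
      ((if j = i - 3 then 1 else 0) + (if j = i - 4 then 1 else 0)
        + (if j = i - 5 then 1 else 0)) else 0 else 0 := by
  simp only [Hpen0, Matrix.of_apply, Matrix.add_apply, S8_pow, ite_and]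
  have h : ∀ m : Fin 8, (i = j + m) = (j = i - m) := by
    intro m; rw [eq_iff_iff, eq_sub_iff_add_eq, eq_comm]
  simp only [h]; rfl

lemma Hprop_entry (x y : Fin 2) (t s i j : Fin 8) :
    Hprop0 (x, t, i) (y, s, j) =
      (if s = t + 1 then if j = i + n t y x then 1 else 0 else 0)
      + (if s = t - 1 then if j = i - n (t - 1) x y then 1 else 0 else 0) := by
  simp only [Hprop0, Matrix.of_apply, Matrix.conjTranspose_apply, Bmat_entry, ite_and,
    Finset.sum_add_distrib]
  congr 1
  · rw [Finset.sum_ite_eq]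
    simp only [Finset.mem_univ, if_true]
    split_ifs <;> simp
  · have : ∀ u : Fin 8, (t = u + 1) = (t - 1 = u) := by
      intro u; rw [eq_iff_iff, sub_eq_iff_eq_add]
    simp only [this]
    rw [Finset.sum_ite_eq]
    have h : ∀ m : Fin 8, (i = j + m) = (j = i - m) := by
      intro m; rw [eq_iff_iff, eq_sub_iff_add_eq, eq_comm]
    simp only [Finset.mem_univ, if_true, h]

lemma A_mulVec (v : G0V → ℂ) (x : Fin 2) (t i : Fin 8) :
    (Ag0 *ᵥ v) (x, t, i) =
      (v (x, t, i - 3) + v (x, t, i - 4) + v (x, t, i - 5))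
      + (∑ y, v (y, t + 1, i + n t y x)) + ∑ y, v (y, t - 1, i - n (t - 1) x y) := by
  have h1 : (Hpen0 *ᵥ v) (x, t, i) =
      v (x, t, i - 3) + v (x, t, i - 4) + v (x, t, i - 5) := by
    simp only [Matrix.mulVec, dotProduct, Fintype.sum_prod_type, Hpen_entry, ite_mul, zero_mul,
      add_mul, one_mul]
    simp [Finset.sum_add_distrib]
  have h2 : (Hprop0 *ᵥ v) (x, t, i) =
      (∑ y, v (y, t + 1, i + n t y x)) + ∑ y, v (y, t - 1, i - n (t - 1) x y) := by
    simp only [Matrix.mulVec, dotProduct, Fintype.sum_prod_type, Hprop_entry, ite_mul, zero_mul,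
      add_mul, one_mul, Finset.sum_add_distrib]
    simp
  rw [Ag0, Matrix.add_mulVec, Pi.add_apply, h1, h2]; ring

/-- Fourier transform in the ancilla register. -/
noncomputable def F (k : Fin 8) (v : G0V → ℂ) (x : Fin 2) (t : Fin 8) : ℂ :=
  ∑ j, e (k * j) * v (x, t, j)

lemma fin_mul_add : ∀ k i j : Fin 8, k * (i + j) = k * i + k * j := by decide
lemma fin_mul_neg : ∀ k i : Fin 8, k * (-i) = -(k * i) := by decide

lemma shift_sum (k m : Fin 8) (f : Fin 8 → ℂ) :
    ∑ j, e (k * j) * f (j - m) = e (k * m) * ∑ j, e (k * j) * f j := by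
  rw [← Equiv.sum_comp (Equiv.addRight m), Finset.mul_sum]
  refine Finset.sum_congr rfl fun j _ => ?_
  simp only [Equiv.coe_addRight, add_sub_cancel_right, fin_mul_add, e_add]
  ring

lemma shift_sum' (k m : Fin 8) (f : Fin 8 → ℂ) :
    ∑ j, e (k * j) * f (j + m) = e (-(k * m)) * ∑ j, e (k * j) * f j := by
  have := shift_sum k (-m) f
  simpa only [sub_neg_eq_add, fin_mul_neg] using this

/-- the penalty value in sector `k` -/
noncomputable def pen (k : Fin 8) : ℂ := e (k * 3) + e (k * 4) + e (k * 5)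

lemma F_A (k : Fin 8) (v : G0V → ℂ) (x : Fin 2) (t : Fin 8) :
    F k (Ag0 *ᵥ v) x t = pen k * F k v x t
      + (∑ y, e (-(k * n t y x)) * F k v y (t + 1))
      + ∑ y, e (k * n (t - 1) x y) * F k v y (t - 1) := by
  unfold F pen
  simp only [A_mulVec, mul_add, Finset.sum_add_distrib, Fin.sum_univ_two]
  rw [shift_sum k 3 (fun j => v (x, t, j)), shift_sum k 4 (fun j => v (x, t, j)),
    shift_sum k 5 (fun j => v (x, t, j)), shift_sum' k _ (fun j => v (0, t + 1, j)),
    shift_sum' k _ (fun j => v (1, t + 1, j)), shift_sum k _ (fun j => v (0, t - 1, j)),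
    shift_sum k _ (fun j => v (1, t - 1, j))]
  ring

lemma sum_e (j : Fin 8) : ∑ k : Fin 8, e (k * j) = if j = 0 then 8 else 0 := by
  have h : ∀ j : Fin 8, j ≠ 0 → ∃ k : Fin 8, e (k * j) ≠ 1 := by
    intro j hj
    refine ⟨1, ?_⟩
    rw [← e_zero, Ne, e_inj]; simpa using hj
  split_ifs with hj
  · subst hj; simp [e_zero]
  · obtain ⟨m, hm⟩ := h j hj
    have : e (m * j) * ∑ k : Fin 8, e (k * j) = ∑ k : Fin 8, e (k * j) := by
      rw [Finset.mul_sum, ← Equiv.sum_comp (Equiv.addRight m) (fun k => e (k * j))]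
      refine Finset.sum_congr rfl fun k _ => ?_
      have h2 : ∀ k m j : Fin 8, (k + m) * j = m * j + k * j := by decide
      simp only [Equiv.coe_addRight, h2, e_add]
    have h3 : (e (m * j) - 1) * ∑ k : Fin 8, e (k * j) = 0 := by
      linear_combination this
    exact (mul_eq_zero.mp h3).resolve_left (sub_ne_zero.mpr hm)

lemma F_inv (v : G0V → ℂ) (x : Fin 2) (t j : Fin 8) :
    ∑ k, e (-(k * j)) * F k v x t = 8 * v (x, t, j) := by
  unfold F
  simp only [Finset.mul_sum]
  rw [Finset.sum_comm]
  have : ∀ i : Fin 8, ∑ k, e (-(k * j)) * (e (k * i) * v (x, t, i))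
      = (if i = j then 8 else 0) * v (x, t, i) := by
    intro i
    have h1 : ∀ k i j : Fin 8, -(k * j) + k * i = k * (i - j) := by decide
    simp only [← mul_assoc, ← e_add, h1]
    rw [← Finset.sum_mul, sum_e]
    simp only [sub_eq_zero]
  simp only [this]
  simp

/-- energy identity -/
lemma energy (k : Fin 8) (w : Fin 2 → Fin 8 → ℂ) (μ p : ℝ)
    (h : ∀ x t, (μ : ℂ) * w x t = (p : ℂ) * w x t
      + (∑ y, e (-(k * n t y x)) * w y (t + 1))
      + ∑ y, e (k * n (t - 1) x y) * w y (t - 1)) :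
    (μ - p) * ∑ t, (Complex.normSq (w 0 t) + Complex.normSq (w 1 t))
      = ∑ t, 2 * (starRingEnd ℂ (w 0 (t + 1)) * (e (k * n t 0 0) * w 0 t + e (k * n t 0 1) * w 1 t)
        + starRingEnd ℂ (w 1 (t + 1)) *
          (e (k * n t 1 0) * w 0 t + e (k * n t 1 1) * w 1 t)).re := by
  set G : Fin 8 → ℂ := fun t =>
    starRingEnd ℂ (w 0 (t + 1)) * (e (k * n t 0 0) * w 0 t + e (k * n t 0 1) * w 1 t)
        + starRingEnd ℂ (w 1 (t + 1)) *
          (e (k * n t 1 0) * w 0 t + e (k * n t 1 1) * w 1 t) with hG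
  have key : ∀ t, (((μ - p) * (Complex.normSq (w 0 t) + Complex.normSq (w 1 t)) : ℝ) : ℂ)
      = starRingEnd ℂ (G t) + G (t - 1) := by
    intro t
    push_cast
    rw [← Complex.mul_conj, ← Complex.mul_conj]
    have h0 := h 0 t
    have h1 := h 1 t
    simp only [Fin.sum_univ_two] at h0 h1
    simp only [hG, map_add, map_mul, conj_e, Complex.conj_conj, sub_add_cancel]
    linear_combination starRingEnd ℂ (w 0 t) * h0 + starRingEnd ℂ (w 1 t) * h1
  have key2 : ∀ t, (μ - p) * (Complex.normSq (w 0 t) + Complex.normSq (w 1 t))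
      = (G t).re + (G (t - 1)).re := by
    intro t
    have := congrArg Complex.re (key t)
    simpa only [Complex.ofReal_re, Complex.add_re, Complex.conj_re] using this
  rw [Finset.mul_sum]
  simp only [key2, Finset.sum_add_distrib]
  have := Equiv.sum_comp (Equiv.subRight (1 : Fin 8)) (fun t => (G t).re)
  simp only [Equiv.subRight_apply] at this
  rw [this, ← Finset.mul_sum, two_mul]

lemma clock_shift (f : Fin 8 → ℝ) : ∑ t, f (t + 1) = ∑ t, f t :=
  Equiv.sum_comp (Equiv.addRight (1 : Fin 8)) f

lemma even_bound (a b c d m1 m2 m3 m4 : ℂ) (h1 : ‖m1‖ = 1) (h2 : ‖m2‖ = 1) (h3 : ‖m3‖ = 1)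
    (h4 : ‖m4‖ = 1) :
    -2 * (Complex.normSq a + Complex.normSq b + (Complex.normSq c + Complex.normSq d))
    ≤ 2 * (starRingEnd ℂ a * (m1 * c + m2 * d) + starRingEnd ℂ b * (m3 * c + m4 * d)).re := by
  have hb : |(starRingEnd ℂ a * (m1 * c + m2 * d) + starRingEnd ℂ b * (m3 * c + m4 * d)).re|
      ≤ (‖a‖ + ‖b‖) * (‖c‖ + ‖d‖) := by
    refine (Complex.abs_re_le_norm _).trans ((norm_add_le _ _).trans ?_)
    rw [norm_mul, norm_mul, Complex.norm_conj, Complex.norm_conj, add_mul]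
    have e1 : ‖m1 * c + m2 * d‖ ≤ ‖c‖ + ‖d‖ := by
      refine (norm_add_le _ _).trans ?_
      rw [norm_mul, norm_mul, h1, h2, one_mul, one_mul]
    have e2 : ‖m3 * c + m4 * d‖ ≤ ‖c‖ + ‖d‖ := by
      refine (norm_add_le _ _).trans ?_
      rw [norm_mul, norm_mul, h3, h4, one_mul, one_mul]
    gcongr
  have := (abs_le.mp hb).1
  simp only [Complex.normSq_eq_norm_sq]
  nlinarith [sq_nonneg (‖a‖ - ‖b‖), sq_nonneg (‖c‖ - ‖d‖), sq_nonneg (‖a‖ + ‖b‖ - ‖c‖ - ‖d‖)]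

lemma odd_id (a b c d m1 m2 m3 m4 : ℂ) (h1 : m1 * starRingEnd ℂ m1 = 1)
    (h2 : m2 * starRingEnd ℂ m2 = 1) (h3 : m3 * starRingEnd ℂ m3 = 1)
    (h4 : m4 * starRingEnd ℂ m4 = 1) (h : m1 * starRingEnd ℂ m2 = - (m3 * starRingEnd ℂ m4)) :
    Complex.normSq (Real.sqrt 2 * a + (m1 * c + m2 * d)) +
      Complex.normSq (Real.sqrt 2 * b + (m3 * c + m4 * d))
    = 2 * (Complex.normSq a + Complex.normSq b + (Complex.normSq c + Complex.normSq d))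
     + Real.sqrt 2 * (2 *
     (starRingEnd ℂ a * (m1 * c + m2 * d) + starRingEnd ℂ b * (m3 * c + m4 * d)).re) := by
  have hconj := congrArg (starRingEnd ℂ) h
  simp only [map_mul, map_neg, Complex.conj_conj] at hconj
  set Z := starRingEnd ℂ a * (m1 * c + m2 * d) + starRingEnd ℂ b * (m3 * c + m4 * d) with hZ
  have hz : ((2 * Z.re : ℝ) : ℂ) = Z + starRingEnd ℂ Z := by
    rw [Complex.add_conj]
  apply Complex.ofReal_injective
  rw [Complex.ofReal_add, Complex.ofReal_add, Complex.ofReal_mul (Real.sqrt 2), hz]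
  push_cast
  simp only [← Complex.mul_conj, hZ, map_add, map_mul, Complex.conj_conj, Complex.conj_ofReal]
  linear_combination (a * starRingEnd ℂ a + b * starRingEnd ℂ b) * sq2
    + (c * starRingEnd ℂ c) * (h1 + h3) + (d * starRingEnd ℂ d) * (h2 + h4)
    + c * starRingEnd ℂ d * h + d * starRingEnd ℂ c * hconj

/-- the penalty value in sector `k`, as a real number -/
noncomputable def penR : Fin 8 → ℝ :=
  ![3, -1 - Real.sqrt 2, 1, -1 + Real.sqrt 2, -1, -1 + Real.sqrt 2, 1, -1 - Real.sqrt 2]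

lemma pen_eq (k : Fin 8) : pen k = (penR k : ℂ) := by
  have h := omega_four
  have e2 : e 2 = omega ^ 2 := rfl
  have e6 : e 6 = omega ^ 6 := rfl
  have o6 : omega ^ 6 = - omega ^ 2 := by linear_combination omega ^ 2 * h
  have hs := sqrt_omega
  fin_cases k
  · change e 0 + e 0 + e 0 = ((3 : ℝ) : ℂ)
    rw [e_zero]; push_cast; ring
  · change e 3 + e 4 + e 5 = ((-1 - Real.sqrt 2 : ℝ) : ℂ)
    push_cast; rw [e3, e4, e5, o5, h, hs]; ring
  · change e 6 + e 0 + e 2 = ((1 : ℝ) : ℂ)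
    rw [e6, o6, e_zero, e2]; push_cast; ring
  · change e 1 + e 4 + e 7 = ((-1 + Real.sqrt 2 : ℝ) : ℂ)
    push_cast; rw [e1', e4, e7, o7, h, hs]; ring
  · change e 4 + e 0 + e 4 = ((-1 : ℝ) : ℂ)
    rw [e4, h, e_zero]; push_cast; ring
  · change e 7 + e 4 + e 1 = ((-1 + Real.sqrt 2 : ℝ) : ℂ)
    push_cast; rw [e1', e4, e7, o7, h, hs]; ring
  · change e 2 + e 0 + e 6 = ((1 : ℝ) : ℂ)
    rw [e6, o6, e_zero, e2]; push_cast; ring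
  · change e 5 + e 4 + e 3 = ((-1 - Real.sqrt 2 : ℝ) : ℂ)
    push_cast; rw [e3, e4, e5, o5, h, hs]; ring

/-- the sector eigenvalue equation -/
def Sec (k : Fin 8) (μ : ℝ) (w : Fin 2 → Fin 8 → ℂ) : Prop :=
  ∀ x t, (μ : ℂ) * w x t = (penR k : ℂ) * w x t
      + (∑ y, e (-(k * n t y x)) * w y (t + 1))
      + ∑ y, e (k * n (t - 1) x y) * w y (t - 1)

lemma sec_F (μ : ℝ) (v : G0V → ℂ) (hv : Ag0 *ᵥ v = (μ : ℂ) • v) (k : Fin 8) :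
    Sec k μ (F k v) := by
  intro x t
  rw [← pen_eq, ← F_A, hv]
  simp only [F, Pi.smul_apply, smul_eq_mul, Finset.mul_sum]
  exact Finset.sum_congr rfl fun j _ => by ring

/-- squared norm -/
noncomputable def N (w : Fin 2 → Fin 8 → ℂ) : ℝ :=
  ∑ t, (Complex.normSq (w 0 t) + Complex.normSq (w 1 t))

lemma N_nonneg (w) : 0 ≤ N w :=
  Finset.sum_nonneg fun _ _ => add_nonneg (Complex.normSq_nonneg _) (Complex.normSq_nonneg _)

lemma pair_zero {f g : Fin 8 → ℂ} (h : ∑ t, (Complex.normSq (f t) + Complex.normSq (g t)) = 0)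
    (t : Fin 8) : f t = 0 ∧ g t = 0 := by
  rw [Finset.sum_eq_zero_iff_of_nonneg (fun _ _ => add_nonneg (Complex.normSq_nonneg _)
    (Complex.normSq_nonneg _))] at h
  have := h t (Finset.mem_univ _)
  have h1 := Complex.normSq_nonneg (f t)
  have h2 := Complex.normSq_nonneg (g t)
  exact ⟨Complex.normSq_eq_zero.mp (by linarith), Complex.normSq_eq_zero.mp (by linarith)⟩

lemma N_zero {w} (h : N w = 0) (x t) : w x t = 0 := by
  have := pair_zero h t
  fin_cases x
  · exact this.1
  · exact this.2

/-- residual -/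
noncomputable def Q (k : Fin 8) (w : Fin 2 → Fin 8 → ℂ) : ℝ :=
  ∑ t, (Complex.normSq (Real.sqrt 2 * w 0 (t + 1)
        + (e (k * n t 0 0) * w 0 t + e (k * n t 0 1) * w 1 t)) +
      Complex.normSq (Real.sqrt 2 * w 1 (t + 1)
        + (e (k * n t 1 0) * w 0 t + e (k * n t 1 1) * w 1 t)))

lemma Q_nonneg (k w) : 0 ≤ Q k w :=
  Finset.sum_nonneg fun _ _ => add_nonneg (Complex.normSq_nonneg _) (Complex.normSq_nonneg _)

lemma N_double (w : Fin 2 → Fin 8 → ℂ) :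
    ∑ t, (Complex.normSq (w 0 (t + 1)) + Complex.normSq (w 1 (t + 1)) +
      (Complex.normSq (w 0 t) + Complex.normSq (w 1 t))) = 2 * N w := by
  rw [Finset.sum_add_distrib,
    clock_shift (fun t => Complex.normSq (w 0 t) + Complex.normSq (w 1 t)), N]
  ring

lemma sec_even {k μ w} (h : Sec k μ w) : 0 ≤ (μ - penR k + 4) * N w := by
  have he := energy k w μ (penR k) h
  have : ∑ t, -2 * (Complex.normSq (w 0 (t + 1)) + Complex.normSq (w 1 (t + 1)) +
      (Complex.normSq (w 0 t) + Complex.normSq (w 1 t))) ≤ (μ - penR k) * N w := by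
    rw [N, he]
    exact Finset.sum_le_sum fun t _ => even_bound _ _ _ _ _ _ _ _ (norm_e _) (norm_e _)
      (norm_e _) (norm_e _)
  rw [← Finset.mul_sum, N_double] at this
  linarith

lemma odd_rel : ∀ t k : Fin 8, (k : ℕ) % 2 = 1 →
    k * n t 0 0 + -(k * n t 0 1) = k * n t 1 0 + -(k * n t 1 1) + 4 := by decide

lemma sec_odd {k : Fin 8} {μ : ℝ} {w : Fin 2 → Fin 8 → ℂ} (hk : (k : ℕ) % 2 = 1) (h : Sec k μ w) :
    Q k w = Real.sqrt 2 * ((μ - penR k + 2 * Real.sqrt 2) * N w) := by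
  have he := energy k w μ (penR k) h
  have h1 : ∀ i, e i * starRingEnd ℂ (e i) = 1 := fun i => by rw [conj_e, e_mul_neg]
  have : Q k w = ∑ t, (2 * (Complex.normSq (w 0 (t + 1)) + Complex.normSq (w 1 (t + 1)) +
      (Complex.normSq (w 0 t) + Complex.normSq (w 1 t))) + Real.sqrt 2 * (2 *
        (starRingEnd ℂ (w 0 (t + 1)) * (e (k * n t 0 0) * w 0 t + e (k * n t 0 1) * w 1 t)
        + starRingEnd ℂ (w 1 (t + 1)) *
          (e (k * n t 1 0) * w 0 t + e (k * n t 1 1) * w 1 t)).re)) := by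
    refine Finset.sum_congr rfl fun t _ => odd_id _ _ _ _ _ _ _ _ (h1 _) (h1 _) (h1 _) (h1 _) ?_
    rw [conj_e, conj_e, ← e_add, ← e_add, odd_rel t k hk, e_add_four]
  rw [this, Finset.sum_add_distrib, ← Finset.mul_sum, ← Finset.mul_sum, N_double, ← he]
  change _ + Real.sqrt 2 * (_ * N w) = _
  have := Real.mul_self_sqrt (show (0:ℝ) ≤ 2 by norm_num)
  linear_combination -2 * N w * this

lemma sqrt2_lb : (1.4 : ℝ) < Real.sqrt 2 := by
  apply Real.lt_sqrt_of_sq_lt; norm_num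

lemma sec_bound {k μ w} (h : Sec k μ w) (hN : 0 < N w) : e1 ≤ μ := by
  have hs := sqrt2_lb
  have h2 := sec_even h
  have h3 : 0 ≤ μ - penR k + 4 := nonneg_of_mul_nonneg_left h2 hN
  have odd : (k : ℕ) % 2 = 1 → 0 ≤ μ - penR k + 2 * Real.sqrt 2 := by
    intro hk
    have := sec_odd hk h
    have hq := Q_nonneg k w
    rw [this] at hq
    exact nonneg_of_mul_nonneg_left (nonneg_of_mul_nonneg_right hq (by linarith)) hN
  unfold e1
  fin_cases k <;> simp [penR] at h3 odd <;> linarith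

lemma sec_zero {k w} (hk : k ≠ 1) (hk' : k ≠ 7) (h : Sec k e1 w) : N w = 0 := by
  by_contra hne
  have hN : 0 < N w := lt_of_le_of_ne (N_nonneg w) (Ne.symm hne)
  have hs := sqrt2_lb
  have h2 := sec_even h
  have h3 : 0 ≤ e1 - penR k + 4 := nonneg_of_mul_nonneg_left h2 hN
  have odd : (k : ℕ) % 2 = 1 → 0 ≤ e1 - penR k + 2 * Real.sqrt 2 := by
    intro hk
    have := sec_odd hk h
    have hq := Q_nonneg k w
    rw [this] at hq
    exact nonneg_of_mul_nonneg_left (nonneg_of_mul_nonneg_right hq (by linarith)) hN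
  unfold e1 at h3 odd
  fin_cases k <;> simp [penR] at h3 odd hk hk' <;> linarith

lemma sec_step {k w} (hk : k = 1 ∨ k = 7) (h : Sec k e1 w) (x : Fin 2) (t : Fin 8) :
    w x (t + 1) = -(Real.sqrt 2 : ℂ)⁻¹ * ∑ y, e (k * n t x y) * w y t := by
  have hQ : Q k w = 0 := by
    have hp : penR k = -1 - Real.sqrt 2 := by rcases hk with rfl | rfl <;> rfl
    rw [sec_odd (by rcases hk with rfl | rfl <;> rfl) h, hp, e1]; ring
  have h2 := pair_zero hQ t
  rw [Fin.sum_univ_two]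
  fin_cases x
  · change w 0 (t + 1) = -(Real.sqrt 2 : ℂ)⁻¹ * (e (k * n t 0 0) * w 0 t + e (k * n t 0 1) * w 1 t)
    linear_combination (Real.sqrt 2 : ℂ)⁻¹ * h2.1 - w 0 (t + 1) * rinv
  · change w 1 (t + 1) = -(Real.sqrt 2 : ℂ)⁻¹ * (e (k * n t 1 0) * w 0 t + e (k * n t 1 1) * w 1 t)
    linear_combination (Real.sqrt 2 : ℂ)⁻¹ * h2.2 - w 1 (t + 1) * rinv

/-- clock matrix -/
noncomputable def C (t : Fin 8) : Matrix (Fin 2) (Fin 2) ℂ := fun x z => clockCoef z t x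

lemma C_eq : C = ![1, Hmat, 1, Hmat * Tmat, 1, Hmat * Tmat, 1, Hmat] := by
  funext t
  have h1 : ∀ t : Fin 8, (t = 0 ∨ t = 2 ∨ t = 4 ∨ t = 6) → C t = 1 := by
    intro t h
    ext x z
    rw [C, clockCoef, if_pos h, Matrix.one_apply]
  have h2 : ∀ t : Fin 8, ¬(t = 0 ∨ t = 2 ∨ t = 4 ∨ t = 6) → (t = 1 ∨ t = 7) → C t = Hmat := by
    intro t h h'
    ext x z
    rw [C, clockCoef, if_neg h, if_pos h']
  have h3 : ∀ t : Fin 8, ¬(t = 0 ∨ t = 2 ∨ t = 4 ∨ t = 6) → ¬(t = 1 ∨ t = 7) →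
      C t = Hmat * Tmat := by
    intro t h h'
    ext x z
    rw [C, clockCoef, if_neg h, if_neg h']
  fin_cases t
  · exact h1 0 (by decide)
  · exact h2 1 (by decide) (by decide)
  · exact h1 2 (by decide)
  · exact h3 3 (by decide) (by decide)
  · exact h1 4 (by decide)
  · exact h3 5 (by decide) (by decide)
  · exact h1 6 (by decide)
  · exact h2 7 (by decide) (by decide)

lemma rr : (Real.sqrt 2 : ℂ)⁻¹ * (Real.sqrt 2 : ℂ)⁻¹ = 1 / 2 := by
  rw [← mul_inv, sq2]; norm_num

lemma HH : Hmatᴴ = Hmat := by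
  rw [H_eq]; ext a b
  fin_cases a <;> fin_cases b <;> simp [Matrix.conjTranspose_apply]

lemma H_sq : Hmat * Hmat = 1 := by
  rw [H_eq]; ext a b
  fin_cases a <;> fin_cases b <;> simp [Matrix.mul_apply, Fin.sum_univ_two, rr] <;> norm_num

lemma TT : Tmatᴴ * Tmat = 1 := by
  ext a b
  fin_cases a <;> fin_cases b <;>
    simp [Tmat, Matrix.mul_apply, Matrix.conjTranspose_apply, Fin.sum_univ_two, conj_omega,
      omega_ne]

lemma HT_unit : (Hmat * Tmat)ᴴ * (Hmat * Tmat) = 1 := by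
  rw [Matrix.conjTranspose_mul, HH, Matrix.mul_assoc, ← Matrix.mul_assoc Hmat, H_sq,
    Matrix.one_mul, TT]

lemma HT_unit' : (Hmat * Tmat) * (Hmat * Tmat)ᴴ = 1 := mul_eq_one_comm.mp HT_unit

lemma C_unit (t : Fin 8) : (C t)ᴴ * C t = 1 := by
  rw [C_eq]
  fin_cases t
  all_goals first
    | exact HT_unit
    | (change Hmatᴴ * Hmat = 1; rw [HH, H_sq])
    | (change (1 : Matrix (Fin 2) (Fin 2) ℂ)ᴴ * 1 = _; rw [Matrix.conjTranspose_one, Matrix.one_mul])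

lemma gate_unit (t : Fin 8) : (gate t)ᴴ * gate t = 1 := by
  unfold gate
  fin_cases t
  all_goals first
    | exact HT_unit
    | (change Hmatᴴ * Hmat = 1; rw [HH, H_sq])
    | (change (Hmat * Tmat)ᴴᴴ * (Hmat * Tmat)ᴴ = _; rw [Matrix.conjTranspose_conjTranspose, HT_unit'])

lemma C_step (t : Fin 8) : C (t + 1) = gate t * C t := by
  rw [C_eq]; unfold gate
  fin_cases t
  · exact (Matrix.mul_one _).symm
  · exact H_sq.symm
  · exact (Matrix.mul_one _).symm
  · exact HT_unit.symm
  · exact (Matrix.mul_one _).symm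
  · exact HT_unit.symm
  · exact (Matrix.mul_one _).symm
  · exact H_sq.symm

lemma C_back (t : Fin 8) : (gate t)ᴴ * C (t + 1) = C t := by
  rw [C_step, ← Matrix.mul_assoc, gate_unit, Matrix.one_mul]

lemma C_zero : C 0 = 1 := by rw [C_eq]; rfl

lemma prop_sol (w : Fin 2 → Fin 8 → ℂ)
    (h : ∀ x t, w x (t + 1) = ∑ y, gate t x y * w y t) (x : Fin 2) (t : Fin 8) :
    w x t = ∑ z, C t x z * w z 0 := by
  have H : ∀ m : ℕ, ∀ x, w x (Fin.ofNat 8 m) = ∑ z, C (Fin.ofNat 8 m) x z * w z 0 := by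
    intro m
    induction m with
    | zero =>
      intro x
      change w x 0 = ∑ z, C 0 x z * w z 0
      simp [C_zero, Matrix.one_apply]
    | succ m ih =>
      intro x
      have : (Fin.ofNat 8 (m+1)) = Fin.ofNat 8 m + 1 := by
        ext; simp [Fin.val_add]
      rw [this, h, C_step]
      simp only [ih, Matrix.mul_apply, Fin.sum_univ_two]
      ring
  have := H t x
  have ht : Fin.ofNat 8 (t : ℕ) = t := by ext; simp
  rwa [ht] at this

lemma sol1 {w} (h : Sec 1 e1 w) (x t) : w x t = ∑ z, C t x z * w z 0 := by
  apply prop_sol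
  intro x t
  rw [sec_step (Or.inl rfl) h, Finset.mul_sum]
  refine Finset.sum_congr rfl fun y _ => ?_
  rw [gate_entry, one_mul]; ring

lemma sol7 {w} (h : Sec 7 e1 w) (x t) : w x t = ∑ z, starRingEnd ℂ (C t x z) * w z 0 := by
  have := prop_sol (fun x t => starRingEnd ℂ (w x t)) ?_ x t
  · have := congrArg (starRingEnd ℂ) this
    simpa only [Complex.conj_conj, map_sum, map_mul] using this
  intro x t
  change starRingEnd ℂ (w x (t + 1)) = ∑ y, gate t x y * starRingEnd ℂ (w y t)
  rw [sec_step (Or.inr rfl) h, Finset.mul_sum, map_sum]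
  refine Finset.sum_congr rfl fun y _ => ?_
  have h7 : ∀ i : Fin 8, -(7 * i) = i := by decide
  rw [gate_entry, map_mul, map_mul, conj_e, h7, map_neg, map_inv₀, Complex.conj_ofReal]; ring

lemma c8 : (((1 : ℝ) / Real.sqrt 8 : ℝ) : ℂ) * (((1 : ℝ) / Real.sqrt 8 : ℝ) : ℂ) = 1 / 8 := by
  rw [← Complex.ofReal_mul, div_mul_div_comm, Real.mul_self_sqrt (by norm_num)]
  norm_num

lemma omegaVec_eq (j : Fin 8) : omegaVec j = (((1 : ℝ) / Real.sqrt 8 : ℝ) : ℂ) * e (-j) := by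
  unfold omegaVec
  congr 1
  rw [zpow_neg, zpow_natCast]
  change (e j)⁻¹ = _
  exact inv_eq_of_mul_eq_one_right (e_mul_neg j)

lemma psi0 (z x : Fin 2) (t j : Fin 8) : psi z 0 (x, t, j) = 1 / 8 * C t x z * e (-j) := by
  rw [← c8]
  simp only [psi, if_true, omegaVec_eq, C]; ring

lemma psi1_conj (z : Fin 2) : psi z 1 = fun p => starRingEnd ℂ (psi z 0 p) := by
  funext p; simp [psi]

lemma psi1 (z x : Fin 2) (t j : Fin 8) :
    psi z 1 (x, t, j) = 1 / 8 * starRingEnd ℂ (C t x z) * e j := by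
  rw [psi1_conj]; simp only [psi0, map_mul, conj_e, neg_neg, map_div₀, map_one, map_ofNat]

lemma A_conj (v : G0V → ℂ) (p : G0V) :
    (Ag0 *ᵥ (fun q => starRingEnd ℂ (v q))) p = starRingEnd ℂ ((Ag0 *ᵥ v) p) := by
  obtain ⟨x, t, i⟩ := p
  simp only [A_mulVec, map_add, map_sum]

lemma A_psi0 (z : Fin 2) : Ag0 *ᵥ psi z 0 = ((e1 : ℝ) : ℂ) • psi z 0 := by
  funext ⟨x, t, i⟩
  rw [A_mulVec, Pi.smul_apply, smul_eq_mul]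
  simp only [psi0]
  have hm : ∀ m : Fin 8, e (-(i - m)) = e (-i) * e m := by
    intro m; rw [← e_add]; congr 1; abel
  have hp : ∀ m : Fin 8, e (-(i + m)) = e (-i) * e (-m) := by
    intro m; rw [← e_add]; congr 1; abel
  have hpen := pen_eq 1
  have hpr : penR 1 = -1 - Real.sqrt 2 := rfl
  rw [hpr] at hpen
  simp only [pen, one_mul] at hpen
  have hb := congrFun (congrFun (C_back t) x) z
  have hf := congrFun (congrFun (C_step (t - 1)) x) z
  rw [sub_add_cancel] at hf
  simp only [Matrix.mul_apply, Fin.sum_univ_two, Matrix.conjTranspose_apply, gate_entry,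
    star_mul', star_neg, RCLike.star_def, conj_e, map_inv₀, Complex.conj_ofReal] at hb hf
  simp only [hm, hp, Fin.sum_univ_two, e1]
  push_cast at hpen ⊢
  have r := rinv
  linear_combination (1 / 8 * C t x z * e (-i)) * hpen
    - (1 / 8 * e (-i) * (Real.sqrt 2 : ℂ)) * hb + (1 / 8 * e (-i) * (Real.sqrt 2 : ℂ)) * hf
    - (1 / 8 * e (-i)) * (e (-n t 0 x) * C (t + 1) 0 z + e (-n t 1 x) * C (t + 1) 1 z
      + e (n (t - 1) x 0) * C (t - 1) 0 z + e (n (t - 1) x 1) * C (t - 1) 1 z) * r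

lemma A_psi (z a : Fin 2) : Ag0 *ᵥ psi z a = ((e1 : ℝ) : ℂ) • psi z a := by
  fin_cases a
  · exact A_psi0 z
  · change Ag0 *ᵥ psi z 1 = ((e1 : ℝ) : ℂ) • psi z 1
    rw [psi1_conj]
    funext p
    rw [A_conj, A_psi0]
    simp

lemma C_orth (t : Fin 8) (z z' : Fin 2) :
    starRingEnd ℂ (C t 0 z) * C t 0 z' + starRingEnd ℂ (C t 1 z) * C t 1 z'
      = if z = z' then 1 else 0 := by
  have := congrFun (congrFun (C_unit t) z) z'
  simpa [Matrix.mul_apply, Fin.sum_univ_two, Matrix.one_apply, Matrix.conjTranspose_apply]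
    using this

lemma sum_split (f : Fin 2 → Fin 8 → ℂ) (g : Fin 8 → ℂ) :
    ∑ p : G0V, f p.1 p.2.1 * g p.2.2 = (∑ t, (f 0 t + f 1 t)) * ∑ j, g j := by
  simp only [Fintype.sum_prod_type, Fin.sum_univ_two, Finset.sum_add_distrib, add_mul,
    Finset.sum_mul_sum]

lemma dot00 (z z' : Fin 2) :
    dotProduct (star (psi z 0)) (psi z' 0) = if z = z' then 1 else 0 := by
  have : dotProduct (star (psi z 0)) (psi z' 0) = ∑ p : G0V,
      (starRingEnd ℂ (C p.2.1 p.1 z) * C p.2.1 p.1 z') * (1 / 64 : ℂ) := by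
    refine Finset.sum_congr rfl fun ⟨x, t, j⟩ _ => ?_
    simp only [Pi.star_apply, psi0, RCLike.star_def, map_mul, conj_e, neg_neg]
    have := e_mul_neg j
    simp only [map_div₀, map_one, map_ofNat]
    linear_combination (1 / 64 * starRingEnd ℂ (C t x z) * C t x z') * this
  rw [this, sum_split (fun x t => starRingEnd ℂ (C t x z) * C t x z') (fun _ => 1 / 64)]
  simp only [C_orth]
  split_ifs <;> simp <;> norm_num

lemma dot01 (z z' : Fin 2) : dotProduct (star (psi z 0)) (psi z' 1) = 0 := by
  have : dotProduct (star (psi z 0)) (psi z' 1) = ∑ p : G0V,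
      (1 / 64 * starRingEnd ℂ (C p.2.1 p.1 z) * starRingEnd ℂ (C p.2.1 p.1 z')) *
        e (p.2.2 * 2) := by
    refine Finset.sum_congr rfl fun ⟨x, t, j⟩ _ => ?_
    have h2 : ∀ j : Fin 8, j * 2 = j + j := by decide
    simp only [Pi.star_apply, psi0, psi1, RCLike.star_def, map_mul, conj_e, neg_neg, h2, e_add]
    simp only [map_div₀, map_one, map_ofNat]
    ring
  rw [this, sum_split (fun x t => 1 / 64 * starRingEnd ℂ (C t x z) * starRingEnd ℂ (C t x z'))
    (fun j => e (j * 2)), sum_e]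
  simp

lemma dot_conj (v u : G0V → ℂ) :
    dotProduct (star (fun p => starRingEnd ℂ (v p))) (fun p => starRingEnd ℂ (u p))
      = starRingEnd ℂ (dotProduct (star v) u) := by
  simp [dotProduct, map_sum]

lemma orth (z a z' a' : Fin 2) :
    dotProduct (star (psi z a)) (psi z' a') = if z = z' ∧ a = a' then 1 else 0 := by
  have h11 : ∀ z z', dotProduct (star (psi z 1)) (psi z' 1) = if z = z' then 1 else 0 := by
    intro z z'
    rw [psi1_conj, psi1_conj, dot_conj, dot00]; split_ifs <;> simp
  have h10 : ∀ z z', dotProduct (star (psi z 1)) (psi z' 0) = 0 := by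
    intro z z'
    have := dot_conj (psi z 0) (psi z' 1)
    rw [dot01, ← psi1_conj] at this
    simpa [psi1_conj] using this
  fin_cases a <;> fin_cases a' <;> simp [dot00, dot01, h11, h10]

lemma lin_indep : LinearIndependent ℂ (fun za : Fin 2 × Fin 2 => psi za.1 za.2) := by
  rw [Fintype.linearIndependent_iff]
  intro g hg i
  have := congrArg (fun u => dotProduct (star (psi i.1 i.2)) u) hg
  simp only [dotProduct_sum, dotProduct_smul, orth, dotProduct_zero, ← Prod.ext_iff,
    smul_eq_mul, mul_ite, mul_one, mul_zero, Finset.sum_ite_eq, Finset.mem_univ, if_true] at this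
  exact this

lemma mem_span_of_eig (v : G0V → ℂ) (hv : Ag0 *ᵥ v = ((e1 : ℝ) : ℂ) • v) :
    v ∈ Submodule.span ℂ (Set.range fun za : Fin 2 × Fin 2 => psi za.1 za.2) := by
  have hs := sec_F e1 v hv
  have hz : ∀ k, k ≠ 1 → k ≠ 7 → ∀ x t, F k v x t = 0 := fun k h1 h7 x t =>
    N_zero (sec_zero h1 h7 (hs k)) x t
  have hv2 : v = ∑ z, (F 1 v z 0 • psi z 0 + F 7 v z 0 • psi z 1) := by
    funext ⟨x, t, j⟩
    have hi := F_inv v x t j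
    simp only [Fin.sum_univ_eight] at hi
    rw [hz 0 (by decide) (by decide), hz 2 (by decide) (by decide), hz 3 (by decide) (by decide),
      hz 4 (by decide) (by decide), hz 5 (by decide) (by decide), hz 6 (by decide) (by decide),
      sol1 (hs 1) x t, sol7 (hs 7) x t] at hi
    have h7 : ∀ i : Fin 8, -(7 * i) = i := by decide
    rw [h7] at hi
    simp only [Fin.sum_univ_two, one_mul] at hi
    simp only [Fin.sum_univ_two, Pi.add_apply, Pi.smul_apply, smul_eq_mul, psi0, psi1]
    linear_combination -(1 / 8) * hi
  rw [hv2]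
  refine Submodule.sum_mem _ fun z _ => Submodule.add_mem _ ?_ ?_
  · exact Submodule.smul_mem _ _ (Submodule.subset_span ⟨(z, 0), rfl⟩)
  · exact Submodule.smul_mem _ _ (Submodule.subset_span ⟨(z, 1), rfl⟩)

lemma eig_eq : Module.End.eigenspace (Matrix.mulVecLin Ag0) ((e1 : ℝ) : ℂ)
    = Submodule.span ℂ (Set.range fun za : Fin 2 × Fin 2 => psi za.1 za.2) := by
  apply le_antisymm
  · intro v hv
    rw [Module.End.mem_eigenspace_iff, Matrix.mulVecLin_apply] at hv
    exact mem_span_of_eig v hv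
  · rw [Submodule.span_le]
    rintro _ ⟨⟨z, a⟩, rfl⟩
    rw [SetLike.mem_coe, Module.End.mem_eigenspace_iff, Matrix.mulVecLin_apply]
    exact A_psi z a

lemma eig_bound (μ : ℝ) (h : Module.End.HasEigenvalue (Matrix.mulVecLin Ag0) ((μ : ℝ) : ℂ)) :
    e1 ≤ μ := by
  obtain ⟨v, hv⟩ := h.exists_hasEigenvector
  have hne := hv.2
  have hv1 : Ag0 *ᵥ v = (μ : ℂ) • v := by
    have := hv.apply_eq_smul
    rwa [Matrix.mulVecLin_apply] at this
  by_contra hlt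
  apply hne
  have hz : ∀ k x t, F k v x t = 0 := by
    intro k
    apply N_zero
    by_contra hN
    exact hlt (sec_bound (sec_F μ v hv1 k) (lt_of_le_of_ne (N_nonneg _) (Ne.symm hN)))
  funext ⟨x, t, j⟩
  have := F_inv v x t j
  simp only [hz, mul_zero, Finset.sum_const_zero] at this
  simpa using this.symm

lemma eig_finrank : Module.finrank ℂ
    (Module.End.eigenspace (Matrix.mulVecLin Ag0) ((e1 : ℝ) : ℂ)) = 4 := by
  rw [eig_eq, finrank_span_eq_card lin_indep]; simp

end GGP


/-- The smallest eigenvalue of the 128×128 symmetric 0-1 matrix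
`A(g₀)` equals `e₁ = −1 − 3√2`, and the corresponding eigenspace is four-dimensional,
with orthonormal basis `{ψ_{z,a} : z, a ∈ {0,1}}`. -/
theorem g0_ground_space :
    Module.End.HasEigenvalue (Matrix.mulVecLin Ag0) ((e1 : ℝ) : ℂ)
    ∧ (∀ μ : ℝ, Module.End.HasEigenvalue (Matrix.mulVecLin Ag0) ((μ : ℝ) : ℂ) → e1 ≤ μ)
    ∧ Module.End.eigenspace (Matrix.mulVecLin Ag0) ((e1 : ℝ) : ℂ)
        = Submodule.span ℂ (Set.range fun za : Fin 2 × Fin 2 => psi za.1 za.2)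
    ∧ Module.finrank ℂ
        (Module.End.eigenspace (Matrix.mulVecLin Ag0) ((e1 : ℝ) : ℂ)) = 4
    ∧ (∀ z a z' a' : Fin 2,
        dotProduct (star (psi z a)) (psi z' a')
          = if z = z' ∧ a = a' then 1 else 0) := by
  refine ⟨?_, GGP.eig_bound, GGP.eig_eq, GGP.eig_finrank, GGP.orth⟩
  intro h
  have h4 := GGP.eig_finrank
  have hb : Module.End.eigenspace (Matrix.mulVecLin Ag0) ((e1 : ℝ) : ℂ) = ⊥ := h
  rw [hb] at h4
  simp at h4
end

section
/- The two-particle Bose–Hubbard Hamiltonian on the graph g₀ has strictly positive ground energy: λ₂^1(g₀) > 0. Equivalently, the operator (A(g₀)⊗1 + 1⊗A(g₀) + 2·Σ_v |v⟩⟨v|⊗|v⟩⟨v| − 2e₁·1), restricted to the symmetric subspace of ℂ^{128}⊗ℂ^{128} (where v ranges over the 128 vertices of g₀), has trivial nullspace. -/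
open scoped Matrix

namespace BH

variable {V : Type*} [Fintype V] [DecidableEq V]

/-- The operator `M` acting on the `w`-th factor of the `N`-fold tensor power
`(ℂ^V)^{⊗N}`, the latter identified with `ℂ^{V^N}`. -/
noncomputable def onFactor (N : ℕ) (M : Matrix V V ℂ) (w : Fin N) :
    Matrix (Fin N → V) (Fin N → V) ℂ :=
  Matrix.of fun x y =>
    (if ∀ u, u ≠ w → x u = y u then (1 : ℂ) else 0) * M (x w) (y w)

/-- The Bose–Hubbard interaction term
`Σ_{k ∈ V} Σ_{w ≠ w'} (|k⟩⟨k|)^{(w)} (|k⟩⟨k|)^{(w')}`, a diagonal matrix whose diagonal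
entry at a configuration `x : Fin N → V` counts the ordered pairs of distinct particles
sitting at a common vertex. -/
noncomputable def interaction (V : Type*) [DecidableEq V] (N : ℕ) :
    Matrix (Fin N → V) (Fin N → V) ℂ :=
  Matrix.of fun x y =>
    if x = y then
      (((Finset.univ : Finset (Fin N × Fin N)).filter
          fun p => p.1 ≠ p.2 ∧ x p.1 = x p.2).card : ℂ)
    else 0

/-- The `N`-particle Bose–Hubbard Hamiltonian `H_G^N` (with hopping and interaction
strengths equal to `1`) for the graph with adjacency matrix `A`. -/
noncomputable def bhHam (A : Matrix V V ℂ) (N : ℕ) :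
    Matrix (Fin N → V) (Fin N → V) ℂ :=
  (∑ w : Fin N, onFactor N A w) + interaction V N

/-- The bosonic (symmetric) subspace `Z_N(G)`: states invariant under every permutation
of the `N` tensor factors. -/
def symmStates (V : Type*) (N : ℕ) : Set ((Fin N → V) → ℂ) :=
  { ψ | ∀ σ : Equiv.Perm (Fin N), ∀ x : Fin N → V, ψ (x ∘ σ) = ψ x }

/-- The ground energy (smallest eigenvalue) of the compression of a Hermitian matrix `H`
to a subspace given as a set `Z` of states: the infimum of the Rayleigh quotients
`⟨ψ, H ψ⟩` over unit vectors `ψ ∈ Z`. -/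
noncomputable def groundEnergy {ι : Type*} [Fintype ι]
    (H : Matrix ι ι ℂ) (Z : Set (ι → ℂ)) : ℝ :=
  sInf { r : ℝ | ∃ ψ ∈ Z, dotProduct (star ψ) ψ = 1 ∧
    r = (dotProduct (star ψ) (H.mulVec ψ)).re }

/-- `μ(G)`: the smallest eigenvalue of the adjacency matrix `A = A(G)`. -/
noncomputable def mu (A : Matrix V V ℂ) : ℝ :=
  groundEnergy A Set.univ

/-- `λ_N^1(G)`: the smallest eigenvalue of `H(G,N)`, the restriction of
`H_G^N − N μ(G)·1` to the symmetric subspace `Z_N(G)`. -/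
noncomputable def lambda1 (A : Matrix V V ℂ) (N : ℕ) : ℝ :=
  groundEnergy (bhHam A N - ((N : ℂ) * (mu A : ℂ)) • 1) (symmStates V N)

end BH

open GG

/-- The operator `A(g₀)⊗1 + 1⊗A(g₀) + 2·Σ_v |v⟩⟨v|⊗|v⟩⟨v| − 2e₁·1` on `ℂ^{128}⊗ℂ^{128}`. -/
noncomputable def twoParticleOp : Matrix (G0V × G0V) (G0V × G0V) ℂ :=
  Matrix.of fun p q =>
    (if p.2 = q.2 then Ag0 p.1 q.1 else 0)
      + (if p.1 = q.1 then Ag0 p.2 q.2 else 0)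
      + (if p = q ∧ p.1 = p.2 then 2 else 0)
      - (if p = q then 2 * (e1 : ℂ) else 0)

namespace G0Aux

/-! ### Matrix entries of the graph -/

lemma omega_prim : IsPrimitiveRoot omega 8 := by
  have h := Complex.isPrimitiveRoot_exp 8 (by norm_num)
  have e : omega = Complex.exp (2 * Real.pi * Complex.I / (8 : ℕ)) := by
    unfold omega
    congr 1
    push_cast
    ring
  rw [e]
  exact h

lemma omega_pow4 : omega ^ 4 = -1 := by
  unfold omega
  rw [← Complex.exp_nat_mul, ← Complex.exp_pi_mul_I]
  congr 1
  push_cast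
  ring

lemma omega_star : (starRingEnd ℂ) omega = - omega ^ 3 := by
  have h1 : (starRingEnd ℂ) omega * omega = 1 := by
    unfold omega
    rw [← Complex.exp_conj, ← Complex.exp_add, ← Complex.exp_zero]
    congr 1
    have h4 : (starRingEnd ℂ) 4 = 4 := Complex.conj_ofNat 4
    simp [h4]
    ring
  linear_combination (-omega ^ 3) * h1 + (starRingEnd ℂ) omega * omega_pow4

lemma omega_inj (a b : Fin 8) : omega ^ (a : ℕ) = omega ^ (b : ℕ) ↔ a = b := by
  constructor
  · intro h
    exact Fin.ext (omega_prim.pow_inj a.2 b.2 h)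
  · rintro rfl
    rfl

/-- Exponents of `-√2 U_t`. -/
def ex : Fin 8 → Fin 2 → Fin 2 → Fin 8 :=
  ![![![4, 4], ![4, 0]], ![![4, 4], ![4, 0]], ![![4, 5], ![4, 1]], ![![4, 4], ![3, 7]],
    ![![4, 5], ![4, 1]], ![![4, 4], ![3, 7]], ![![4, 4], ![4, 0]], ![![4, 4], ![4, 0]]]

lemma gate_entry (t : Fin 8) (x y : Fin 2) :
    ((-(Real.sqrt 2) : ℂ) • gate t) x y = omega ^ ((ex t x y : Fin 8) : ℕ) := by
  have h4 := omega_pow4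
  have hs := omega_star
  have h5 : omega ^ 5 = - omega := by linear_combination omega * h4
  have h7 : omega ^ 7 = - omega ^ 3 := by linear_combination omega ^ 3 * h4
  fin_cases t <;> fin_cases x <;> fin_cases y <;>
    simp [gate, ex, Hmat, Tmat, hs, h4, h5, h7]

lemma ofNat_succ8 (n : ℕ) : Fin.ofNat 8 (n + 1) = Fin.ofNat 8 n + 1 := by
  apply Fin.ext
  simp [Fin.val_add]

lemma add_right8 : ∀ (k i j : Fin 8), (i = j + k) ↔ (j = i - k) := by decide

lemma sub_swap8 : ∀ (k i j : Fin 8), (k = i - j) ↔ (j = i - k) := by decide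

lemma S8_pow (n : ℕ) (i j : Fin 8) : (S8 ^ n) i j = if i = j + Fin.ofNat 8 n then 1 else 0 := by
  induction n generalizing i with
  | zero => simp [Matrix.one_apply]
  | succ n ih =>
    rw [pow_succ', Matrix.mul_apply, ofNat_succ8, ← add_assoc]
    have hS : ∀ a b : Fin 8, S8 a b = if b = a - 1 then 1 else 0 := by
      intro a b
      simp only [S8, Matrix.of_apply, add_right8 1]
    simp only [ih, hS]
    rw [Finset.sum_eq_single (i - 1)]
    · rw [if_pos rfl, one_mul]
      congr 1
      apply propext
      rw [add_right8 1 i, eq_comm]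
    · intro b _ hb
      simp [hb]
    · simp

lemma S8_pow3 (i j : Fin 8) : (S8 ^ 3) i j = if i = j + 3 then 1 else 0 := S8_pow 3 i j
lemma S8_pow4 (i j : Fin 8) : (S8 ^ 4) i j = if i = j + 4 then 1 else 0 := S8_pow 4 i j
lemma S8_pow5 (i j : Fin 8) : (S8 ^ 5) i j = if i = j + 5 then 1 else 0 := S8_pow 5 i j

/-- The real adjacency matrix. -/
noncomputable def AR (p q : G0V) : ℝ :=
  (∑ t : Fin 8,
    ((if p.2.1 = t ∧ q.2.1 = t + 1 then
        (if ex t q.1 p.1 = q.2.2 - p.2.2 then (1 : ℝ) else 0) else 0)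
      + (if p.2.1 = t + 1 ∧ q.2.1 = t then
        (if ex t p.1 q.1 = p.2.2 - q.2.2 then (1 : ℝ) else 0) else 0)))
  + (if p.1 = q.1 ∧ p.2.1 = q.2.1 then
      ((if p.2.2 = q.2.2 + 3 then (1 : ℝ) else 0) + (if p.2.2 = q.2.2 + 4 then 1 else 0)
        + (if p.2.2 = q.2.2 + 5 then 1 else 0)) else 0)

lemma Bmat_entry (t : Fin 8) (x y : Fin 2) (i j : Fin 8) :
    Bmat ((-(Real.sqrt 2) : ℂ) • gate t) (x, i) (y, j)
      = ((if ex t x y = i - j then (1 : ℝ) else 0 : ℝ) : ℂ) := by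
  unfold Bmat
  simp only [Matrix.of_apply, gate_entry, omega_inj]
  split_ifs <;> simp

lemma Ag0_entry (p q : G0V) : Ag0 p q = (AR p q : ℂ) := by
  unfold Ag0 AR
  rw [Matrix.add_apply]
  push_cast
  congr 1
  · unfold Hprop0
    simp only [Matrix.of_apply, Matrix.conjTranspose_apply, Bmat_entry]
    refine Finset.sum_congr rfl fun t _ => ?_
    congr 1
    · split_ifs <;> simp
    · split_ifs <;> simp
  · unfold Hpen0
    simp only [Matrix.of_apply, Matrix.add_apply, S8_pow3, S8_pow4, S8_pow5]
    split_ifs <;> simp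
/-! ### Real quadratic form -/

lemma neg8 : (-1 : Fin 8) = 7 ∧ (-2 : Fin 8) = 6 ∧ (-3 : Fin 8) = 5 ∧ (-4 : Fin 8) = 4 ∧
    (-5 : Fin 8) = 3 ∧ (-6 : Fin 8) = 2 ∧ (-7 : Fin 8) = 1 := by decide

noncomputable def od (h : Fin 8 → ℝ) (j : Fin 8) : ℝ := (h j - h (j + 4)) / 2
noncomputable def ev (h : Fin 8 → ℝ) (j : Fin 8) : ℝ := (h j + h (j + 4)) / 2

/-- Action of the block `B(U_t)`. -/
noncomputable def BB (t : Fin 8) (g : Fin 2 → Fin 8 → ℝ) (x : Fin 2) (j : Fin 8) : ℝ :=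
  ∑ y : Fin 2, g y (j - ex t x y)

lemma norm_split (h : Fin 8 → ℝ) :
    ∑ j, h j ^ 2 = ∑ j, od h j ^ 2 + ∑ j, ev h j ^ 2 := by
  simp [od, ev, Fin.sum_univ_eight]
  ring

lemma pen_id (s : ℝ) (hs : s ^ 2 = 2) (h : Fin 8 → ℝ) :
    ∑ j, h j * (h (j - 3) + h (j - 4) + h (j - 5))
      = s / 4 * ∑ j, (s * od h j - (od h (j + 1) + od h (j - 1))) ^ 2
        - (1 + s) * ∑ j, od h j ^ 2
        + ∑ j, (ev h j + ev h (j + 1)) ^ 2 - ∑ j, ev h j ^ 2 := by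
  have key : s / 4 * ∑ j, (s * od h j - (od h (j + 1) + od h (j - 1))) ^ 2
      = ∑ j, (s / 2 * od h j ^ 2 - od h j * (od h (j + 1) + od h (j - 1))
          + s / 4 * (od h (j + 1) + od h (j - 1)) ^ 2) := by
    rw [Finset.mul_sum]
    refine Finset.sum_congr rfl fun j _ => ?_
    linear_combination (s / 4 * od h j ^ 2
      - od h j * (od h (j + 1) + od h (j - 1)) / 2) * hs
  rw [key]
  simp [od, ev, neg8, Fin.sum_univ_eight]
  ring

lemma hop_split (t : Fin 8) (u g : Fin 2 → Fin 8 → ℝ) :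
    ∑ x, ∑ j, u x j * BB t g x j
      = ∑ x, ∑ j, od (u x) j * BB t (fun y => od (g y)) x j
        + ∑ x, ∑ j, ev (u x) j * BB t (fun y => ev (g y)) x j := by
  fin_cases t <;> simp [od, ev, BB, ex, neg8, Fin.sum_univ_eight, Fin.sum_univ_two] <;> ring

lemma hop_odd (t : Fin 8) (g : Fin 2 → Fin 8 → ℝ) :
    ∑ x, ∑ j, BB t (fun y => od (g y)) x j ^ 2 = 2 * ∑ x, ∑ j, od (g x) j ^ 2 := by
  fin_cases t <;> simp [od, BB, ex, neg8, Fin.sum_univ_eight, Fin.sum_univ_two] <;> ring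

lemma hop_even (t : Fin 8) (g : Fin 2 → Fin 8 → ℝ) :
    ∑ x, ∑ j, BB t g x j ^ 2 ≤ 4 * ∑ x, ∑ j, g x j ^ 2 := by
  have shift : ∀ (h : Fin 8 → ℝ) (a : Fin 8), ∑ j, h (j - a) ^ 2 = ∑ j, h j ^ 2 := fun h a =>
    Equiv.sum_comp (Equiv.subRight a) (fun j => h j ^ 2)
  have h1 : ∀ x, ∑ j, BB t g x j ^ 2 ≤ 2 * ∑ y, ∑ j, g y j ^ 2 := by
    intro x
    calc ∑ j, BB t g x j ^ 2
        ≤ ∑ j, (2 * g 0 (j - ex t x 0) ^ 2 + 2 * g 1 (j - ex t x 1) ^ 2) := by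
          refine Finset.sum_le_sum fun j _ => ?_
          simp only [BB, Fin.sum_univ_two]
          nlinarith [sq_nonneg (g 0 (j - ex t x 0) - g 1 (j - ex t x 1))]
      _ = 2 * ∑ y, ∑ j, g y j ^ 2 := by
          rw [Finset.sum_add_distrib, ← Finset.mul_sum, ← Finset.mul_sum, shift, shift,
            Fin.sum_univ_two]
          ring
  have := h1 0
  have := h1 1
  rw [Fin.sum_univ_two (fun x => ∑ j, BB t g x j ^ 2)]
  linarith

lemma hop_bound (s : ℝ) (hs : s ^ 2 = 2) (t : Fin 8) (u g : Fin 2 → Fin 8 → ℝ) :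
    s / 2 * ∑ x, ∑ j, (s * od (u x) j + BB t (fun y => od (g y)) x j) ^ 2
      - s * (∑ x, ∑ j, od (u x) j ^ 2 + ∑ x, ∑ j, od (g x) j ^ 2)
      - 2 * (∑ x, ∑ j, ev (u x) j ^ 2 + ∑ x, ∑ j, ev (g x) j ^ 2)
    ≤ 2 * ∑ x, ∑ j, u x j * BB t g x j := by
  have e1 : ∑ x, ∑ j, (s * od (u x) j + BB t (fun y => od (g y)) x j) ^ 2
      = 2 * ∑ x, ∑ j, od (u x) j ^ 2
        + 2 * s * ∑ x, ∑ j, od (u x) j * BB t (fun y => od (g y)) x j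
        + ∑ x, ∑ j, BB t (fun y => od (g y)) x j ^ 2 := by
    simp only [Finset.mul_sum, ← Finset.sum_add_distrib]
    refine Finset.sum_congr rfl fun x _ => Finset.sum_congr rfl fun j _ => ?_
    linear_combination (od (u x) j ^ 2) * hs
  have e2 : 0 ≤ 4 * ∑ x, ∑ j, ev (u x) j ^ 2
        + 4 * ∑ x, ∑ j, ev (u x) j * BB t (fun y => ev (g y)) x j
        + ∑ x, ∑ j, BB t (fun y => ev (g y)) x j ^ 2 := by
    simp only [Finset.mul_sum, ← Finset.sum_add_distrib]
    refine Finset.sum_nonneg fun x _ => Finset.sum_nonneg fun j _ => ?_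
    nlinarith [sq_nonneg (2 * ev (u x) j + BB t (fun y => ev (g y)) x j)]
  have e3 := hop_even t (fun y => ev (g y))
  rw [hop_split, e1, hop_odd]
  generalize (∑ x, ∑ j, od (u x) j * BB t (fun y => od (g y)) x j) = X at *
  nlinarith [congrArg (· * X) hs]

/-- The real quadratic form of `A(g₀)`. -/
noncomputable def qf (f : G0V → ℝ) : ℝ := ∑ p, ∑ q, f p * AR p q * f q

noncomputable def nrm (f : G0V → ℝ) : ℝ := ∑ p, f p ^ 2

/-- time slice -/
noncomputable def sl (f : G0V → ℝ) (t : Fin 8) (x : Fin 2) (j : Fin 8) : ℝ := f (x, t, j)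

lemma sum_V {M : Type*} [AddCommMonoid M] (F : G0V → M) :
    ∑ p, F p = ∑ t, ∑ x, ∑ j, F (x, t, j) := by
  rw [Fintype.sum_prod_type]
  simp only [Fintype.sum_prod_type]
  rw [Finset.sum_comm]

lemma qf_hop (f : G0V → ℝ) (t : Fin 8) :
    ∑ p : G0V, ∑ q : G0V, f p * (if p.2.1 = t + 1 ∧ q.2.1 = t then
        (if ex t p.1 q.1 = p.2.2 - q.2.2 then (1 : ℝ) else 0) else 0) * f q
      = ∑ x, ∑ j, sl f (t + 1) x j * BB t (sl f t) x j := by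
  have h : ∀ (k i j : Fin 8), (k = i - j) ↔ (j = i - k) := sub_swap8
  simp only [sum_V, ite_and]
  rw [Finset.sum_eq_single (t + 1)]
  · refine Finset.sum_congr rfl fun x _ => Finset.sum_congr rfl fun j _ => ?_
    rw [Finset.sum_eq_single t]
    · simp only [if_true, mul_ite, ite_mul, mul_one, mul_zero, zero_mul]
      simp only [h (ex _ _ _)]
      simp [BB, sl, mul_add]
    · intro b _ hb
      simp [hb]
    · simp
  · intro b _ hb
    simp [hb]
  · simp

lemma qf_pen (f : G0V → ℝ) :
    ∑ p : G0V, ∑ q : G0V, f p * (if p.1 = q.1 ∧ p.2.1 = q.2.1 then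
      ((if p.2.2 = q.2.2 + 3 then (1 : ℝ) else 0) + (if p.2.2 = q.2.2 + 4 then 1 else 0)
        + (if p.2.2 = q.2.2 + 5 then 1 else 0)) else 0) * f q
      = ∑ t, ∑ x, ∑ j, sl f t x j * (sl f t x (j - 3) + sl f t x (j - 4) + sl f t x (j - 5)) := by
  have h : ∀ (k i j : Fin 8), (i = j + k) ↔ (j = i - k) := add_right8
  simp only [sum_V, ite_and, h]
  refine Finset.sum_congr rfl fun t _ => Finset.sum_congr rfl fun x _ =>
    Finset.sum_congr rfl fun j _ => ?_
  rw [Finset.sum_eq_single t, Finset.sum_eq_single x]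
  · simp [sl, mul_add, add_mul, Finset.sum_add_distrib]
  · intro b _ hb
    simp [hb.symm]
  · simp
  · intro b _ hb
    simp [hb.symm]
  · simp

lemma qf_eq (f : G0V → ℝ) :
    qf f = ∑ t, 2 * ∑ x, ∑ j, sl f (t + 1) x j * BB t (sl f t) x j
      + ∑ t, ∑ x, ∑ j, sl f t x j * (sl f t x (j - 3) + sl f t x (j - 4) + sl f t x (j - 5)) := by
  rw [← qf_pen]
  simp only [← qf_hop, two_mul]
  unfold qf AR
  simp only [mul_add, add_mul, Finset.sum_add_distrib, Finset.mul_sum, Finset.sum_mul]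
  have cm : ∀ F : G0V → G0V → Fin 8 → ℝ,
      ∑ p, ∑ q, ∑ t, F p q t = ∑ t, ∑ p, ∑ q, F p q t := by
    intro F
    rw [Finset.sum_comm]
    simp only [Finset.sum_comm (s := (Finset.univ : Finset G0V))
      (t := (Finset.univ : Finset (Fin 8)))]
    refine Finset.sum_congr rfl fun t _ => ?_
    rw [Finset.sum_comm]
  rw [cm, cm]
  congr 1
  congr 1
  refine Finset.sum_congr rfl fun t _ => ?_
  rw [Finset.sum_comm]
  refine Finset.sum_congr rfl fun p _ => Finset.sum_congr rfl fun q _ => ?_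
  simp only [and_comm (a := p.2.1 = t + 1)]
  ring
/-! ### Kernel of the one-particle operator -/

lemma e1_eq : e1 = -(1 + 3 * Real.sqrt 2) := by
  unfold e1
  ring

lemma s_sq : Real.sqrt 2 ^ 2 = 2 := Real.sq_sqrt (by norm_num)

lemma s_pos : 0 < Real.sqrt 2 := Real.sqrt_pos.mpr (by norm_num)

lemma s_gap : 0 < 3 * Real.sqrt 2 - 4 := by
  nlinarith [s_sq, s_pos]

lemma Q_bound (f : G0V → ℝ) :
    Real.sqrt 2 / 2 * ∑ t, ∑ x, ∑ j, (Real.sqrt 2 * od (sl f (t + 1) x) j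
        + BB t (fun y => od (sl f t y)) x j) ^ 2
      + Real.sqrt 2 / 4 * ∑ t, ∑ x, ∑ j, (Real.sqrt 2 * od (sl f t x) j
          - (od (sl f t x) (j + 1) + od (sl f t x) (j - 1))) ^ 2
      + (3 * Real.sqrt 2 - 4) * ∑ t, ∑ x, ∑ j, ev (sl f t x) j ^ 2
    ≤ qf f - e1 * nrm f := by
  have hs := s_sq
  set s := Real.sqrt 2 with hsdef
  have hn : nrm f = ∑ t, ∑ x, ∑ j, od (sl f t x) j ^ 2 + ∑ t, ∑ x, ∑ j, ev (sl f t x) j ^ 2 := by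
    unfold nrm
    rw [sum_V]
    simp only [← Finset.sum_add_distrib]
    refine Finset.sum_congr rfl fun t _ => Finset.sum_congr rfl fun x _ => ?_
    rw [Finset.sum_add_distrib, ← norm_split]
    rfl
  have shiftt : ∀ F : Fin 8 → ℝ, ∑ t, F (t + 1) = ∑ t, F t := fun F =>
    Equiv.sum_comp (Equiv.addRight (1 : Fin 8)) F
  have so := shiftt (fun t => ∑ x, ∑ j, od (sl f t x) j ^ 2)
  have se := shiftt (fun t => ∑ x, ∑ j, ev (sl f t x) j ^ 2)
  have hhop := Finset.sum_le_sum (s := Finset.univ)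
    (fun t (_ : t ∈ Finset.univ) => hop_bound s hs t (sl f (t + 1)) (sl f t))
  simp only [Finset.sum_sub_distrib, ← Finset.mul_sum, Finset.sum_add_distrib] at hhop
  have hpen : s / 4 * ∑ t, ∑ x, ∑ j, (s * od (sl f t x) j
          - (od (sl f t x) (j + 1) + od (sl f t x) (j - 1))) ^ 2
        - (1 + s) * ∑ t, ∑ x, ∑ j, od (sl f t x) j ^ 2
        - ∑ t, ∑ x, ∑ j, ev (sl f t x) j ^ 2
      ≤ ∑ t, ∑ x, ∑ j, sl f t x j * (sl f t x (j - 3) + sl f t x (j - 4) + sl f t x (j - 5)) := by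
    rw [Finset.mul_sum, Finset.mul_sum, ← Finset.sum_sub_distrib, ← Finset.sum_sub_distrib]
    refine Finset.sum_le_sum fun t _ => ?_
    rw [Finset.mul_sum, Finset.mul_sum, ← Finset.sum_sub_distrib, ← Finset.sum_sub_distrib]
    refine Finset.sum_le_sum fun x _ => ?_
    rw [pen_id s hs]
    have : 0 ≤ ∑ j, (ev (sl f t x) j + ev (sl f t x) (j + 1)) ^ 2 :=
      Finset.sum_nonneg fun j _ => sq_nonneg _
    linarith
  rw [qf_eq, hn, e1_eq, ← Finset.mul_sum]
  rw [so, se] at hhop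
  linarith

lemma sum3_nonneg (F : Fin 8 → Fin 2 → Fin 8 → ℝ) : 0 ≤ ∑ t, ∑ x, ∑ j, F t x j ^ 2 :=
  Finset.sum_nonneg fun _ _ => Finset.sum_nonneg fun _ _ => Finset.sum_nonneg fun _ _ =>
    sq_nonneg _

lemma sum3_zero (F : Fin 8 → Fin 2 → Fin 8 → ℝ) (h : ∑ t, ∑ x, ∑ j, F t x j ^ 2 = 0) :
    ∀ t x j, F t x j = 0 := by
  intro t x j
  rw [Finset.sum_eq_zero_iff_of_nonneg (fun _ _ => Finset.sum_nonneg fun _ _ =>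
    Finset.sum_nonneg fun _ _ => sq_nonneg _)] at h
  have h1 := h t (Finset.mem_univ _)
  rw [Finset.sum_eq_zero_iff_of_nonneg (fun _ _ =>
    Finset.sum_nonneg fun _ _ => sq_nonneg _)] at h1
  have h2 := h1 x (Finset.mem_univ _)
  rw [Finset.sum_eq_zero_iff_of_nonneg (fun _ _ => sq_nonneg _)] at h2
  exact pow_eq_zero_iff (two_ne_zero) |>.mp (h2 j (Finset.mem_univ _))

lemma Q_nonneg (f : G0V → ℝ) : 0 ≤ qf f - e1 * nrm f := by
  refine le_trans ?_ (Q_bound f)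
  have h1 := sum3_nonneg (fun t x j => Real.sqrt 2 * od (sl f (t + 1) x) j
        + BB t (fun y => od (sl f t y)) x j)
  have h2 := sum3_nonneg (fun t x j => Real.sqrt 2 * od (sl f t x) j
          - (od (sl f t x) (j + 1) + od (sl f t x) (j - 1)))
  have h3 := sum3_nonneg (fun t x j => ev (sl f t x) j)
  have := s_pos
  have := s_gap
  positivity

lemma Q_ker (f : G0V → ℝ) (hq : qf f - e1 * nrm f ≤ 0) :
    (∀ x t j, f (x, t, j + 4) = - f (x, t, j)) ∧
    (∀ x t j, f (x, t, j + 1) + f (x, t, j - 1) = Real.sqrt 2 * f (x, t, j)) ∧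
    (∀ x t j, Real.sqrt 2 * f (x, t + 1, j)
      = - (f (0, t, j - ex t x 0) + f (1, t, j - ex t x 1))) := by
  have hb := le_trans (Q_bound f) hq
  have h1 := sum3_nonneg (fun t x j => Real.sqrt 2 * od (sl f (t + 1) x) j
        + BB t (fun y => od (sl f t y)) x j)
  have h2 := sum3_nonneg (fun t x j => Real.sqrt 2 * od (sl f t x) j
          - (od (sl f t x) (j + 1) + od (sl f t x) (j - 1)))
  have h3 := sum3_nonneg (fun t x j => ev (sl f t x) j)
  have p1 : 0 < Real.sqrt 2 / 2 := by have := s_pos; positivity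
  have p2 : 0 < Real.sqrt 2 / 4 := by have := s_pos; positivity
  have p3 := s_gap
  have m1 := mul_nonneg p1.le h1
  have m2 := mul_nonneg p2.le h2
  have m3 := mul_nonneg p3.le h3
  have z1 := sum3_zero _ ((mul_eq_zero.mp (le_antisymm (by linarith) m1)).resolve_left p1.ne')
  have z2 := sum3_zero _ ((mul_eq_zero.mp (le_antisymm (by linarith) m2)).resolve_left p2.ne')
  have z3 := sum3_zero _ ((mul_eq_zero.mp (le_antisymm (by linarith) m3)).resolve_left p3.ne')
  have a1 : ∀ x t j, f (x, t, j + 4) = - f (x, t, j) := by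
    intro x t j
    have := z3 t x j
    simp only [ev, sl] at this
    linarith
  have a2 : ∀ t x, od (sl f t x) = sl f t x := by
    intro t x
    ext j
    simp only [od, sl, a1]
    ring
  refine ⟨a1, ?_, ?_⟩
  · intro x t j
    have := z2 t x j
    simp only [a2, sl] at this
    linarith
  · intro x t j
    have := z1 t x j
    simp only [a2, BB, Fin.sum_univ_two, sl] at this
    linarith

/-- Kernel conditions for a complex one-particle state. -/
def Ker (f : G0V → ℂ) : Prop :=
    (∀ x t j, f (x, t, j + 4) = - f (x, t, j)) ∧
    (∀ x t j, f (x, t, j + 1) + f (x, t, j - 1) = (Real.sqrt 2 : ℂ) * f (x, t, j)) ∧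
    (∀ x t j, (Real.sqrt 2 : ℂ) * f (x, t + 1, j)
      = - (f (0, t, j - ex t x 0) + f (1, t, j - ex t x 1)))

noncomputable def QC (f : G0V → ℂ) : ℝ :=
  (dotProduct (star f) (Ag0.mulVec f)).re - e1 * ∑ v, Complex.normSq (f v)

lemma QC_eq (f : G0V → ℂ) :
    QC f = (qf (fun v => (f v).re) - e1 * nrm (fun v => (f v).re))
      + (qf (fun v => (f v).im) - e1 * nrm (fun v => (f v).im)) := by
  have h1 : ∑ v, Complex.normSq (f v) = nrm (fun v => (f v).re) + nrm (fun v => (f v).im) := by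
    unfold nrm
    rw [← Finset.sum_add_distrib]
    refine Finset.sum_congr rfl fun v _ => ?_
    rw [Complex.normSq_apply]
    ring
  have h2 : (dotProduct (star f) (Ag0.mulVec f)).re
      = qf (fun v => (f v).re) + qf (fun v => (f v).im) := by
    unfold qf
    simp only [dotProduct, Matrix.mulVec, Ag0_entry, Finset.mul_sum, Complex.re_sum,
      ← Finset.sum_add_distrib]
    refine Finset.sum_congr rfl fun p _ => Finset.sum_congr rfl fun q _ => ?_
    simp
    ring
  unfold QC
  rw [h1, h2]
  ring

lemma QC_nonneg (f : G0V → ℂ) : 0 ≤ QC f := by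
  rw [QC_eq]
  exact add_nonneg (Q_nonneg _) (Q_nonneg _)

lemma QC_ker (f : G0V → ℂ) (h : QC f ≤ 0) : Ker f := by
  rw [QC_eq] at h
  have n1 := Q_nonneg (fun v => (f v).re)
  have n2 := Q_nonneg (fun v => (f v).im)
  obtain ⟨a1, a2, a3⟩ := Q_ker (fun v => (f v).re) (by linarith)
  obtain ⟨b1, b2, b3⟩ := Q_ker (fun v => (f v).im) (by linarith)
  refine ⟨fun x t j => ?_, fun x t j => ?_, fun x t j => ?_⟩
  · apply Complex.ext
    · simpa using a1 x t j
    · simpa using b1 x t j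
  · apply Complex.ext
    · simpa using a2 x t j
    · simpa using b2 x t j
  · apply Complex.ext
    · simpa using a3 x t j
    · simpa using b3 x t j

/-! ### No two-particle state -/

lemma sC_sq : (Real.sqrt 2 : ℂ) ^ 2 = 2 := by
  rw [← Complex.ofReal_pow, s_sq]
  norm_num

lemma sC_ne : (Real.sqrt 2 : ℂ) ≠ 0 := by
  intro h
  have := sC_sq
  rw [h] at this
  norm_num at this

lemma rec_zero (s : ℂ) (g : Fin 8 → ℂ) (hg : ∀ j, g (j + 1) + g (j - 1) = s * g j)
    (h0 : g 0 = 0) (h1 : g 1 = 0) : ∀ j, g j = 0 := by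
  have h2 : g 2 = 0 := by simpa [h0, h1] using hg 1
  have h3 : g 3 = 0 := by simpa [h1, h2] using hg 2
  have h4 : g 4 = 0 := by simpa [h3, h2] using hg 3
  have h5 : g 5 = 0 := by simpa [h3, h4] using hg 4
  have h6 : g 6 = 0 := by simpa [h5, h4] using hg 5
  have h7 : g 7 = 0 := by simpa [h5, h6] using hg 6
  intro j
  fin_cases j <;> assumption

lemma prop_zero (P : Fin 8 → Prop) (h2 : P 2) (hs : ∀ t, P t → P (t + 1)) : ∀ t, P t := by
  have h3 : P 3 := hs 2 h2
  have h4 : P 4 := hs 3 h3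
  have h5 : P 5 := hs 4 h4
  have h6 : P 6 := hs 5 h5
  have h7 : P 7 := hs 6 h6
  have h0 : P 0 := hs 7 h7
  have h1 : P 1 := hs 0 h0
  intro t
  fin_cases t <;> assumption

lemma fin8_shift : ∀ j k : Fin 8, (k + (j - k) = j) ∧ (k + (j + 1) = k + j + 1) ∧
    (k + (j - 1) = k + j - 1) ∧ (k - 1 + 1 = k) := by decide

/-- symmetric, vanishing on the diagonal, two-term recursion: zero. -/
lemma block_zero (s : ℂ) (hs : s ≠ 0) (M : Fin 8 → Fin 8 → ℂ) (hsym : ∀ j k, M j k = M k j)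
    (hd : ∀ j, M j j = 0) (hr : ∀ j k, M (j + 1) k + M (j - 1) k = s * M j k) :
    ∀ j k, M j k = 0 := by
  have ha : ∀ k, M (k + 1) k = 0 := by
    intro k
    have e1 := hr k (k + 1)
    have e2 := hr k (k - 1)
    have e3 := hr k k
    rw [hd] at e1 e2 e3
    have e4 := hsym (k - 1) (k + 1)
    have e5 := hsym (k - 1) k
    have e6 := hsym (k + 1) k
    have : s * (2 * M (k + 1) k) = 0 := by
      linear_combination s * e3 + s * e6 - e1 + e2 + e4 - s * e5
    rcases mul_eq_zero.mp this with h | h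
    · exact absurd h hs
    · simpa using h
  intro j k
  have := rec_zero s (fun j => M (k + j) k)
    (by intro j; simp only [(fin8_shift j k).2.1, (fin8_shift j k).2.2.1]; exact hr _ _)
    (by simpa using hd k) (ha k) (j - k)
  simpa only [(fin8_shift j k).1] using this

lemma fin8_sub4 : ∀ j : Fin 8, (j - 4 = j + 4) ∧ (j - 5 = (j - 1) + 4) ∧ (j - 0 = j) := by decide

lemma no_two (F : G0V → G0V → ℂ) (hsym : ∀ v w, F v w = F w v) (hd : ∀ v, F v v = 0)
    (hk : ∀ w, Ker (fun v => F v w)) : ∀ v w, F v w = 0 := by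
  have k1 := fun w => (hk w).1
  have k2 := fun w => (hk w).2.1
  have k3 := fun w => (hk w).2.2
  simp only at k1 k2 k3
  have hs2 := sC_sq
  have hs0 := sC_ne
  set s : ℂ := (Real.sqrt 2 : ℂ) with hsdef
  -- diagonal blocks
  have blk : ∀ x t j k, F (x, t, j) (x, t, k) = 0 := fun x t =>
    block_zero s hs0 (fun j k => F (x, t, j) (x, t, k)) (fun _ _ => hsym _ _) (fun _ => hd _)
      (fun j k => k2 (x, t, k) x t j)
  -- relation between clock labels
  have r1 : ∀ w j, s * F (0, 1, j) w = F (0, 2, j) w + F (1, 2, j) w := by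
    intro w j
    have a := k3 w 0 1 j
    have b := k3 w 1 1 j
    have c := k1 w 0 1 j
    have d := k1 w 1 1 j
    simp [ex] at a b
    rw [(fin8_sub4 j).1] at a b
    have a' : s * F (0, 2, j) w = - (F (0, 1, j + 4) w + F (1, 1, j + 4) w) := by
      simpa using a
    have b' : s * F (1, 2, j) w = - (F (0, 1, j + 4) w + F (1, 1, j) w) := by
      simpa using b
    apply mul_left_cancel₀ hs0
    linear_combination F (0, 1, j) w * hs2 - a' - b' + 2 * c + d
  have r3 : ∀ w j, s * F (0, 3, j) w = F (0, 2, j) w + F (1, 2, j - 1) w := by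
    intro w j
    have a := k3 w 0 2 j
    have c := k1 w 0 2 j
    have d := k1 w 1 2 (j - 1)
    simp [ex] at a
    rw [(fin8_sub4 j).1, (fin8_sub4 j).2.1] at a
    have a' : s * F (0, 3, j) w = - (F (0, 2, j + 4) w + F (1, 2, j - 1 + 4) w) := by
      simpa using a
    linear_combination a' - c - d
  have r1' : ∀ w j, s * F w (0, 1, j) = F w (0, 2, j) + F w (1, 2, j) := by
    intro w j
    rw [hsym w, hsym w, hsym w]
    exact r1 w j
  have r3' : ∀ w j, s * F w (0, 3, j) = F w (0, 2, j) + F w (1, 2, j - 1) := by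
    intro w j
    rw [hsym w, hsym w, hsym w]
    exact r3 w j
  have n1 : ∀ j k, F (0, 2, j) (1, 2, k) + F (0, 2, k) (1, 2, j) = 0 := by
    intro j k
    have e := blk 0 1 j k
    linear_combination (s * s) * e - s * r1 (0, 1, k) j - r1' (0, 2, j) k - r1' (1, 2, j) k
      - blk 0 2 j k - blk 1 2 j k - hsym (1, 2, j) (0, 2, k)
  have n3 : ∀ j k, F (0, 2, j) (1, 2, k - 1) + F (0, 2, k) (1, 2, j - 1) = 0 := by
    intro j k
    have e := blk 0 3 j k
    linear_combination (s * s) * e - s * r3 (0, 3, k) j - r3' (0, 2, j) k - r3' (1, 2, j - 1) k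
      - blk 0 2 j k - blk 1 2 (j - 1) (k - 1) - hsym (1, 2, j - 1) (0, 2, k)
  have n10 : F (0, 2, 1) (1, 2, 0) = 0 := by
    have := n3 1 1
    simp at this
    exact this
  have n01 : F (0, 2, 0) (1, 2, 1) = 0 := by linear_combination n1 0 1 - n10
  have n00 : F (0, 2, 0) (1, 2, 0) = 0 := by linear_combination (n1 0 0) / 2
  have n11 : F (0, 2, 1) (1, 2, 1) = 0 := by linear_combination (n1 1 1) / 2
  have c0 : ∀ j, F (0, 2, j) (1, 2, 0) = 0 :=
    rec_zero s (fun j => F (0, 2, j) (1, 2, 0)) (fun j => k2 _ 0 2 j) n00 n10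
  have c1 : ∀ j, F (0, 2, j) (1, 2, 1) = 0 :=
    rec_zero s (fun j => F (0, 2, j) (1, 2, 1)) (fun j => k2 _ 0 2 j) n01 n11
  have off : ∀ j k, F (0, 2, j) (1, 2, k) = 0 := by
    intro j k
    rw [hsym]
    refine rec_zero s (fun k => F (1, 2, k) (0, 2, j)) (fun k => k2 _ 1 2 k) ?_ ?_ k
    · show F (1, 2, _) (0, 2, j) = 0
      rw [hsym]
      exact c0 j
    · show F (1, 2, _) (0, 2, j) = 0
      rw [hsym]
      exact c1 j
  have all2 : ∀ x y j k, F (x, 2, j) (y, 2, k) = 0 := by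
    intro x y j k
    fin_cases x <;> fin_cases y
    · exact blk 0 2 j k
    · exact off j k
    · exact (hsym _ _).trans (off k j)
    · exact blk 1 2 j k
  have prop : ∀ w, (∀ x j, F (x, 2, j) w = 0) → ∀ v, F v w = 0 := by
    intro w h0 v
    obtain ⟨x, t, j⟩ := v
    refine prop_zero (fun t => ∀ x j, F (x, t, j) w = 0) h0 ?_ t x j
    intro t ht x j
    have := k3 w x t j
    rw [ht, ht] at this
    apply mul_left_cancel₀ hs0
    rw [this]
    simp
  intro v w
  refine prop w (fun x j => ?_) v
  rw [hsym]
  exact prop (x, 2, j) (fun y k => all2 y x k j) w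
/-! ### Two-particle energy -/

lemma top_apply (ψ : G0V × G0V → ℂ) (a b : G0V) :
    twoParticleOp.mulVec ψ (a, b) = Ag0.mulVec (fun v => ψ (v, b)) a
      + Ag0.mulVec (fun w => ψ (a, w)) b + (if a = b then 2 * ψ (a, b) else 0)
      - 2 * (e1 : ℂ) * ψ (a, b) := by
  have h1 : ∑ q : G0V × G0V, (if (a, b).2 = q.2 then Ag0 (a, b).1 q.1 else 0) * ψ q
      = Ag0.mulVec (fun v => ψ (v, b)) a := by
    rw [Fintype.sum_prod_type]
    simp only [Matrix.mulVec, dotProduct]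
    refine Finset.sum_congr rfl fun v _ => ?_
    rw [Finset.sum_eq_single b]
    · simp
    · intro w _ hw
      rw [if_neg (Ne.symm hw), zero_mul]
    · simp
  have h2 : ∑ q : G0V × G0V, (if (a, b).1 = q.1 then Ag0 (a, b).2 q.2 else 0) * ψ q
      = Ag0.mulVec (fun w => ψ (a, w)) b := by
    rw [Fintype.sum_prod_type]
    simp only [Matrix.mulVec, dotProduct]
    rw [Finset.sum_eq_single a]
    · simp
    · intro w _ hw
      refine Finset.sum_eq_zero fun u _ => ?_
      rw [if_neg (Ne.symm hw), zero_mul]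
    · simp
  have h3 : ∑ q : G0V × G0V, (if (a, b) = q ∧ (a, b).1 = (a, b).2 then (2 : ℂ) else 0) * ψ q
      = if a = b then 2 * ψ (a, b) else 0 := by
    rw [Finset.sum_eq_single (a, b)]
    · by_cases h : a = b
      · simp [h]
      · simp [h]
    · intro w _ hw
      rw [if_neg (fun h => hw h.1.symm), zero_mul]
    · intro h
      exact absurd (Finset.mem_univ _) h
  have h4 : ∑ q : G0V × G0V, (if (a, b) = q then 2 * (e1 : ℂ) else 0) * ψ q
      = 2 * (e1 : ℂ) * ψ (a, b) := by
    rw [Finset.sum_eq_single (a, b)]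
    · simp
    · intro w _ hw
      rw [if_neg (Ne.symm hw), zero_mul]
    · intro h
      exact absurd (Finset.mem_univ _) h
  rw [← h1, ← h2, ← h3, ← h4, ← Finset.sum_add_distrib, ← Finset.sum_add_distrib,
    ← Finset.sum_sub_distrib]
  simp only [Matrix.mulVec, dotProduct, twoParticleOp, Matrix.of_apply]
  refine Finset.sum_congr rfl fun q _ => ?_
  ring

lemma QC_sum (f : G0V → ℂ) :
    QC f = ∑ v, ((star (f v) * Ag0.mulVec f v).re - e1 * Complex.normSq (f v)) := by
  unfold QC
  rw [Finset.sum_sub_distrib, Finset.mul_sum]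
  simp only [dotProduct, Complex.re_sum, Pi.star_apply]

lemma top_energy (ψ : G0V × G0V → ℂ) :
    (dotProduct (star ψ) (twoParticleOp.mulVec ψ)).re
      = ∑ b, QC (fun v => ψ (v, b)) + ∑ a, QC (fun w => ψ (a, w))
        + ∑ a, 2 * Complex.normSq (ψ (a, a)) := by
  have hd : ∑ a, 2 * Complex.normSq (ψ (a, a))
      = ∑ a : G0V, ∑ b : G0V, if a = b then 2 * Complex.normSq (ψ (a, b)) else 0 := by
    refine Finset.sum_congr rfl fun a _ => ?_
    rw [Finset.sum_ite_eq]
    simp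
  rw [hd]
  simp only [QC_sum]
  rw [Finset.sum_comm, ← Finset.sum_add_distrib, ← Finset.sum_add_distrib]
  unfold dotProduct
  rw [Complex.re_sum, Fintype.sum_prod_type]
  refine Finset.sum_congr rfl fun a _ => ?_
  rw [← Finset.sum_add_distrib, ← Finset.sum_add_distrib]
  refine Finset.sum_congr rfl fun b _ => ?_
  rw [top_apply, Complex.normSq_apply]
  generalize Ag0.mulVec (fun v => ψ (v, b)) a = X
  generalize Ag0.mulVec (fun w => ψ (a, w)) b = Y
  split_ifs <;> simp <;> ring

lemma top_zero (ψ : G0V × G0V → ℂ) (hsym : ∀ a b : G0V, ψ (a, b) = ψ (b, a))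
    (h : (dotProduct (star ψ) (twoParticleOp.mulVec ψ)).re ≤ 0) : ψ = 0 := by
  rw [top_energy] at h
  have n1 : ∀ b ∈ Finset.univ, 0 ≤ QC (fun v => ψ (v, b)) := fun b _ => QC_nonneg _
  have n2 : ∀ a ∈ Finset.univ, 0 ≤ QC (fun w => ψ (a, w)) := fun a _ => QC_nonneg _
  have n3 : ∀ a ∈ Finset.univ, 0 ≤ 2 * Complex.normSq (ψ (a, a)) := fun a _ =>
    mul_nonneg (by norm_num) (Complex.normSq_nonneg _)
  have m1 := Finset.sum_nonneg n1
  have m2 := Finset.sum_nonneg n2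
  have m3 := Finset.sum_nonneg n3
  have z1 := (Finset.sum_eq_zero_iff_of_nonneg n1).mp (by linarith)
  have z3 := (Finset.sum_eq_zero_iff_of_nonneg n3).mp (by linarith)
  have := no_two (fun v w => ψ (v, w)) (fun v w => hsym v w)
    (fun v => by
      have := z3 v (Finset.mem_univ _)
      simpa using this)
    (fun w => QC_ker _ (z1 w (Finset.mem_univ _)).le)
  funext p
  obtain ⟨a, b⟩ := p
  exact this a b

/-! ### The smallest eigenvalue -/

noncomputable def rr (j : Fin 8) : ℝ :=
  (![1, Real.sqrt 2 / 2, 0, -(Real.sqrt 2 / 2), -1, -(Real.sqrt 2 / 2), 0, Real.sqrt 2 / 2] :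
    Fin 8 → ℝ) j

noncomputable def cc (t : Fin 8) (x : Fin 2) : ℝ :=
  (![![1, 0], ![Real.sqrt 2 / 2, Real.sqrt 2 / 2], ![1, 0], ![Real.sqrt 2 / 2, Real.sqrt 2 / 2],
    ![1, 0], ![Real.sqrt 2 / 2, Real.sqrt 2 / 2], ![1, 0], ![Real.sqrt 2 / 2, Real.sqrt 2 / 2]] :
    Fin 8 → Fin 2 → ℝ) t x

/-- A real ground state (not normalised). -/
noncomputable def gs (p : G0V) : ℝ := cc p.2.1 p.1 * rr p.2.2

lemma rr_sq : ∑ j, rr j ^ 2 = 4 := by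
  have hs := s_sq
  simp [rr, Fin.sum_univ_eight]
  linear_combination hs

lemma cc_sq (t : Fin 8) : ∑ x, cc t x ^ 2 = 1 := by
  have hs := s_sq
  fin_cases t <;> simp [cc, Fin.sum_univ_two] <;> linear_combination hs / 2

lemma gs_nrm : nrm gs = 32 := by
  unfold nrm
  rw [sum_V]
  simp only [gs, mul_pow, ← Finset.mul_sum, rr_sq, ← Finset.sum_mul, cc_sq]
  norm_num

lemma gs_pen (t : Fin 8) (x : Fin 2) :
    ∑ j, sl gs t x j * (sl gs t x (j - 3) + sl gs t x (j - 4) + sl gs t x (j - 5))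
      = cc t x ^ 2 * (-4 * (1 + Real.sqrt 2)) := by
  have hs := s_sq
  simp [sl, gs, rr, Fin.sum_univ_eight, neg8]
  linear_combination (-cc t x ^ 2) * hs

lemma gs_hop (t : Fin 8) :
    ∑ x, ∑ j, sl gs (t + 1) x j * BB t (sl gs t) x j = -4 * Real.sqrt 2 := by
  have hs := s_sq
  fin_cases t <;>
    simp [sl, gs, rr, cc, BB, ex, Fin.sum_univ_eight, Fin.sum_univ_two, neg8]
  all_goals linear_combination (-Real.sqrt 2) * hs

lemma gs_Q : qf gs - e1 * nrm gs = 0 := by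
  rw [qf_eq, gs_nrm, e1_eq]
  simp only [gs_hop, gs_pen, ← Finset.sum_mul, cc_sq]
  simp
  ring

lemma mu_le : BH.mu Ag0 ≤ e1 := by
  unfold BH.mu BH.groundEnergy
  apply csInf_le
  · refine ⟨e1, ?_⟩
    rintro r ⟨ψ, -, h1, rfl⟩
    have h := QC_nonneg ψ
    have hn : ∑ v, Complex.normSq (ψ v) = 1 := by
      have := congrArg Complex.re h1
      simp only [dotProduct, Complex.re_sum, Pi.star_apply, Complex.one_re] at this
      rw [← this]
      refine Finset.sum_congr rfl fun v _ => ?_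
      rw [Complex.normSq_apply]
      simp
    unfold QC at h
    rw [hn] at h
    linarith
  · have hc : (Real.sqrt 32)⁻¹ ^ 2 * 32 = 1 := by
      rw [inv_pow, Real.sq_sqrt (by norm_num)]
      norm_num
    set c := (Real.sqrt 32)⁻¹
    have hn : ∑ v, (c * gs v) ^ 2 = 1 := by
      simp only [mul_pow, ← Finset.mul_sum]
      have := gs_nrm
      unfold nrm at this
      rw [this, hc]
    refine ⟨fun v => ((c * gs v : ℝ) : ℂ), Set.mem_univ _, ?_, ?_⟩
    · rw [← Complex.ofReal_one, ← hn]
      push_cast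
      refine Finset.sum_congr rfl fun v _ => ?_
      simp
      ring
    · have h := QC_eq (fun v => ((c * gs v : ℝ) : ℂ))
      have z : qf (fun _ => 0) - e1 * nrm (fun _ => 0) = 0 := by simp [qf, nrm]
      have y : qf (fun v => c * gs v) - e1 * nrm (fun v => c * gs v) = 0 := by
        have : qf (fun v => c * gs v) - e1 * nrm (fun v => c * gs v)
            = c ^ 2 * (qf gs - e1 * nrm gs) := by
          unfold qf nrm
          simp only [mul_sub, Finset.mul_sum]
          congr 1
          · refine Finset.sum_congr rfl fun p _ => Finset.sum_congr rfl fun q _ => ?_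
            ring
          · refine Finset.sum_congr rfl fun p _ => ?_
            ring
        rw [this, gs_Q, mul_zero]
      simp only [Complex.ofReal_re, Complex.ofReal_im, z, y] at h
      unfold QC at h
      have hn2 : ∑ v, Complex.normSq ((c * gs v : ℝ) : ℂ) = 1 := by
        rw [← hn]
        refine Finset.sum_congr rfl fun v _ => ?_
        rw [Complex.normSq_ofReal]
        ring
      rw [hn2] at h
      linarith

/-! ### Transfer to the Bose–Hubbard Hamiltonian -/

lemma bh_entry (a b c d : G0V) :
    BH.bhHam Ag0 2 ![a, b] ![c, d]
      = twoParticleOp (a, b) (c, d) + (if (a, b) = (c, d) then 2 * (e1 : ℂ) else 0) := by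
  have hi : BH.interaction G0V 2 ![a, b] ![c, d]
      = if (a, b) = (c, d) ∧ a = b then 2 else 0 := by
    have hcard : ∀ P : Prop, [Decidable P] → (((Finset.univ : Finset (Fin 2 × Fin 2)).filter
          fun p => p.1 ≠ p.2 ∧ P).card : ℂ) = if P then 2 else 0 := by
      intro P _
      by_cases hP : P
      · simp only [hP, and_true, if_true]
        have : ((Finset.univ : Finset (Fin 2 × Fin 2)).filter fun p => p.1 ≠ p.2).card = 2 := by
          decide
        rw [this]
        norm_num
      · simp [hP]
    have hf : ∀ p : Fin 2 × Fin 2, (p.1 ≠ p.2 ∧ (![a, b] : Fin 2 → G0V) p.1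
        = (![a, b] : Fin 2 → G0V) p.2) ↔ (p.1 ≠ p.2 ∧ a = b) := by
      rintro ⟨i, j⟩
      fin_cases i <;> fin_cases j <;> simp [eq_comm]
    have he : ((![a, b] : Fin 2 → G0V) = ![c, d]) ↔ ((a, b) = (c, d)) := by
      constructor
      · intro h
        have h0 := congrFun h 0
        have h1 := congrFun h 1
        simp only [Matrix.cons_val_zero, Matrix.cons_val_one] at h0 h1
        rw [h0, h1]
      · intro h
        obtain ⟨rfl, rfl⟩ := Prod.mk.inj h
        rfl
    unfold BH.interaction
    simp only [Matrix.of_apply, hf, hcard, he]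
    rw [ite_and]
  unfold BH.bhHam
  rw [Matrix.add_apply, hi, Fin.sum_univ_two, Matrix.add_apply]
  have f0 : BH.onFactor 2 Ag0 0 ![a, b] ![c, d] = if b = d then Ag0 a c else 0 := by
    simp [BH.onFactor, Fin.forall_fin_two]
  have f1 : BH.onFactor 2 Ag0 1 ![a, b] ![c, d] = if a = c then Ag0 b d else 0 := by
    simp [BH.onFactor, Fin.forall_fin_two]
  rw [f0, f1]
  unfold twoParticleOp
  simp only [Matrix.of_apply]
  ring

lemma sum_two (F : (Fin 2 → G0V) → ℂ) : ∑ x, F x = ∑ p : G0V × G0V, F ![p.1, p.2] := by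
  rw [← Equiv.sum_comp (finTwoArrowEquiv G0V).symm]
  rfl

lemma bh_energy (ψ : (Fin 2 → G0V) → ℂ) (m : ℝ) (hn : dotProduct (star ψ) ψ = 1) :
    (dotProduct (star ψ) ((BH.bhHam Ag0 2 - (((2 : ℕ) : ℂ) * (m : ℂ)) • 1).mulVec ψ)).re
      = (dotProduct (star (fun p : G0V × G0V => ψ ![p.1, p.2]))
          (twoParticleOp.mulVec (fun p : G0V × G0V => ψ ![p.1, p.2]))).re + 2 * (e1 - m) := by
  have h1 : dotProduct (star ψ) ((BH.bhHam Ag0 2).mulVec ψ)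
      = dotProduct (star (fun p : G0V × G0V => ψ ![p.1, p.2]))
          (twoParticleOp.mulVec (fun p : G0V × G0V => ψ ![p.1, p.2])) + 2 * (e1 : ℂ) := by
    have h2 : (2 * (e1 : ℂ)) = 2 * (e1 : ℂ) * dotProduct (star ψ) ψ := by rw [hn, mul_one]
    rw [h2]
    simp only [dotProduct]
    rw [sum_two, sum_two, Finset.mul_sum, ← Finset.sum_add_distrib]
    refine Finset.sum_congr rfl fun p _ => ?_
    obtain ⟨a, b⟩ := p
    have : (BH.bhHam Ag0 2).mulVec ψ ![a, b]
        = twoParticleOp.mulVec (fun p : G0V × G0V => ψ ![p.1, p.2]) (a, b)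
          + 2 * (e1 : ℂ) * ψ ![a, b] := by
      simp only [Matrix.mulVec, dotProduct]
      rw [sum_two]
      simp only [bh_entry, add_mul, Finset.sum_add_distrib, ite_mul, zero_mul]
      rw [Finset.sum_ite_eq]
      simp
    rw [this]
    simp only [Pi.star_apply]
    ring
  rw [Matrix.sub_mulVec, dotProduct_sub, h1, Matrix.smul_mulVec, Matrix.one_mulVec,
    dotProduct_smul, hn]
  simp
  ring

lemma norm_one {ι : Type*} [Fintype ι] (ψ : ι → ℂ) (hn : dotProduct (star ψ) ψ = 1) (x : ι) :
    ‖ψ x‖ ≤ 1 := by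
  have h : ∑ x, ‖ψ x‖ ^ 2 = 1 := by
    have := congrArg Complex.re hn
    simp only [dotProduct, Complex.re_sum, Pi.star_apply, Complex.one_re] at this
    rw [← this]
    refine Finset.sum_congr rfl fun v _ => ?_
    rw [← Complex.normSq_eq_norm_sq, Complex.normSq_apply]
    simp
  have h2 : ‖ψ x‖ ^ 2 ≤ 1 := by
    rw [← h]
    exact Finset.single_le_sum (f := fun x => ‖ψ x‖ ^ 2) (fun i _ => sq_nonneg _)
      (Finset.mem_univ x)
  nlinarith [norm_nonneg (ψ x)]

lemma groundEnergy_pos {ι : Type*} [Fintype ι] (H : Matrix ι ι ℂ) (Z : Set (ι → ℂ))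
    (hZ : IsClosed Z) (hne : ∃ ψ ∈ Z, dotProduct (star ψ) ψ = 1)
    (hpos : ∀ ψ ∈ Z, dotProduct (star ψ) ψ = 1 → 0 < (dotProduct (star ψ) (H.mulVec ψ)).re) :
    0 < BH.groundEnergy H Z := by
  have hcompact : IsCompact (Z ∩ {ψ : ι → ℂ | dotProduct (star ψ) ψ = 1}) := by
    apply Metric.isCompact_of_isClosed_isBounded
    · refine hZ.inter (isClosed_eq ?_ continuous_const)
      simp only [dotProduct, Pi.star_apply]
      fun_prop
    · refine (Metric.isBounded_closedBall (x := (0 : ι → ℂ)) (r := 1)).subset ?_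
      rintro ψ ⟨-, hn⟩
      rw [mem_closedBall_zero_iff, pi_norm_le_iff_of_nonneg zero_le_one]
      exact norm_one ψ hn
  have hcont : Continuous (fun ψ : ι → ℂ => (dotProduct (star ψ) (H.mulVec ψ)).re) := by
    simp only [dotProduct, Matrix.mulVec, Pi.star_apply]
    fun_prop
  obtain ⟨φ, hφ, hφ1⟩ := hne
  obtain ⟨ψ, hψ, hmin⟩ := hcompact.exists_isMinOn ⟨φ, hφ, hφ1⟩ hcont.continuousOn
  unfold BH.groundEnergy
  refine lt_of_lt_of_le (hpos ψ hψ.1 hψ.2) ?_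
  refine le_csInf ⟨_, ψ, hψ.1, hψ.2, rfl⟩ ?_
  rintro r ⟨χ, h1, h2, rfl⟩
  exact hmin ⟨h1, h2⟩

lemma symm_swap (ψ : (Fin 2 → G0V) → ℂ) (hs : ψ ∈ BH.symmStates G0V 2) (a b : G0V) :
    ψ ![a, b] = ψ ![b, a] := by
  have h := hs (Equiv.swap 0 1) ![b, a]
  have e : (![b, a] : Fin 2 → G0V) ∘ (Equiv.swap (0 : Fin 2) 1) = ![a, b] := by
    funext i
    fin_cases i <;> simp
  rw [e] at h
  exact h

lemma symm_closed : IsClosed (BH.symmStates G0V 2) := by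
  unfold BH.symmStates
  simp only [Set.ofPred_forall]
  refine isClosed_iInter fun σ => isClosed_iInter fun x => ?_
  exact isClosed_eq (continuous_apply _) (continuous_apply _)

lemma symm_nonempty : ∃ ψ ∈ BH.symmStates G0V 2, dotProduct (star ψ) ψ = 1 := by
  refine ⟨fun x => if x = fun _ => (0, 0, 0) then 1 else 0, ?_, ?_⟩
  · intro σ x
    have : (x ∘ σ = fun _ => ((0, 0, 0) : G0V)) ↔ (x = fun _ => (0, 0, 0)) := by
      constructor
      · intro h
        funext i
        have := congrFun h (σ.symm i)
        simpa using this
      · rintro rfl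
        rfl
    simp only [this]
  · simp only [dotProduct, Pi.star_apply]
    rw [Finset.sum_eq_single (fun _ => ((0, 0, 0) : G0V))]
    · simp
    · intro b _ hb
      rw [if_neg hb, mul_zero]
    · intro h
      exact absurd (Finset.mem_univ _) h

lemma lambda_pos : 0 < BH.lambda1 Ag0 2 := by
  unfold BH.lambda1
  refine groundEnergy_pos _ _ symm_closed symm_nonempty ?_
  intro ψ hs hn
  by_contra hcon
  have hcon := not_lt.mp hcon
  rw [bh_energy ψ _ hn] at hcon
  have hm := mu_le
  have hz := top_zero (fun p : G0V × G0V => ψ ![p.1, p.2])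
    (fun a b => symm_swap ψ hs a b) (by linarith)
  have : dotProduct (star ψ) ψ = 0 := by
    simp only [dotProduct]
    rw [sum_two]
    refine Finset.sum_eq_zero fun p _ => ?_
    have := congrFun hz p
    simp only [Pi.zero_apply] at this
    rw [this, mul_zero]
  rw [this] at hn
  exact zero_ne_one hn

end G0Aux

/-- The two-particle Bose–Hubbard Hamiltonian on the graph `g₀` has
strictly positive ground energy: `λ₂^1(g₀) > 0`.  Equivalently, the operator
`A(g₀)⊗1 + 1⊗A(g₀) + 2·Σ_v |v⟩⟨v|⊗|v⟩⟨v| − 2e₁·1`, restricted to the symmetric subspace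
of `ℂ^{128}⊗ℂ^{128}`, has trivial nullspace. -/
theorem g0_no_two_particle_frustration_free_states :
    0 < BH.lambda1 Ag0 2
    ∧ ∀ ψ : (G0V × G0V) → ℂ, (∀ a b : G0V, ψ (a, b) = ψ (b, a)) →
        twoParticleOp.mulVec ψ = 0 → ψ = 0 := by
  refine ⟨G0Aux.lambda_pos, fun ψ hsym h => G0Aux.top_zero ψ hsym ?_⟩
  rw [h]
  simp
end
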